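/- arXiv:2311.07214 — 3 statements merged into one kernel-verified Lean document; each statement's English description precedes it below -/
import Mathlib

section
/- Let m, n be positive integers, let A be an m×n integer matrix with all entries of absolute value at most Δ, let b ∈ ℤ^m and c ∈ ℤ^n. Suppose the integer program max{cᵀx : Ax = b, x ≥ 0, x ∈ ℤ^n} is feasible, and let x* ∈ ℝ^n be an optimal solution of the linear relaxation max{cᵀx : Ax = b, x ≥ 0, x ∈ ℝ^n} that is an extreme point (vertex) of the polyhedron {x ∈ ℝ^n : Ax = b, x ≥ 0}. Then there exists an optimal solution z* ∈ ℤ^n of the integer program with z* ≥ 0, Az* = b, cᵀz* attaining the integer optimum, and ‖z* − x*‖₁ ≤ m·(2mΔ + 1)^m. -/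
open Matrix

open Topology in
/-- At an extreme point of `{y | L y = b, y i ∈ K i}`, the number of coordinates lying in the
interior of their constraint set is at most the dimension of the target of `L`. -/
lemma card_interior_coords_le_finrank {ι E : Type*} [Fintype ι] [AddCommGroup E] [Module ℝ E]
    [FiniteDimensional ℝ E] (L : (ι → ℝ) →ₗ[ℝ] E) (b : E) (K : ι → Set ℝ) (x : ι → ℝ)
    (hx : x ∈ Set.extremePoints ℝ {y : ι → ℝ | L y = b ∧ ∀ i, y i ∈ K i})
    (I : Finset ι) (hI : ∀ i ∈ I, K i ∈ 𝓝 (x i)) : I.card ≤ Module.finrank ℝ E := by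
  classical
  by_contra! hlt
  let ext : (I → ℝ) →ₗ[ℝ] (ι → ℝ) :=
    { toFun := fun f i => if h : i ∈ I then f ⟨i, h⟩ else 0
      map_add' := by intro f g; ext i; by_cases h : i ∈ I <;> simp [h]
      map_smul' := by intro r f; ext i; by_cases h : i ∈ I <;> simp [h] }
  have hker : LinearMap.ker (L ∘ₗ ext) ≠ ⊥ :=
    LinearMap.ker_ne_bot_of_finrank_lt (by simpa using hlt)
  obtain ⟨f, hf, hf0⟩ := (Submodule.ne_bot_iff _).1 hker
  set μ : ι → ℝ := ext f with hμ
  have hLμ : L μ = 0 := by simpa using hf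
  have hμ0 : μ ≠ 0 := by
    intro h0
    apply hf0
    funext i
    have := congrFun h0 i.1
    simpa [hμ, ext] using this
  have hout : ∀ i, i ∉ I → μ i = 0 := fun i hi => by simp [hμ, ext, hi]
  have hev : ∀ ν : ι → ℝ, (∀ i, i ∉ I → ν i = 0) →
      ∀ᶠ ε : ℝ in 𝓝[>] 0, ∀ i, x i + ε * ν i ∈ K i := by
    intro ν hν
    rw [Filter.eventually_all]
    intro i
    by_cases hi : i ∈ I
    · have hc : Filter.Tendsto (fun ε : ℝ => x i + ε * ν i) (𝓝 0) (𝓝 (x i)) := by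
        have : Continuous (fun ε : ℝ => x i + ε * ν i) := by fun_prop
        simpa using this.tendsto 0
      exact (hc.mono_left nhdsWithin_le_nhds).eventually (hI i hi)
    · exact Filter.Eventually.of_forall fun ε => by simpa [hν i hi] using hx.1.2 i
  obtain ⟨ε, ⟨h1, h2⟩, hε⟩ := (((hev μ hout).and (hev (-μ) fun i hi => by simp [hout i hi])).and
    self_mem_nhdsWithin).exists
  have hε' : (0 : ℝ) < ε := hε
  have m1 : x + ε • μ ∈ {y : ι → ℝ | L y = b ∧ ∀ i, y i ∈ K i} :=
    ⟨by simp [hLμ, hx.1.1], fun i => by simpa using h1 i⟩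
  have m2 : x + ε • (-μ) ∈ {y : ι → ℝ | L y = b ∧ ∀ i, y i ∈ K i} :=
    ⟨by simp [hLμ, hx.1.1], fun i => by simpa using h2 i⟩
  have hseg : x ∈ openSegment ℝ (x + ε • μ) (x + ε • (-μ)) := by
    refine ⟨1 / 2, 1 / 2, by norm_num, by norm_num, by norm_num, ?_⟩
    ext i
    simp only [Pi.add_apply, Pi.smul_apply, smul_eq_mul, Pi.neg_apply]
    ring
  have heq := hx.2 m1 m2 hseg
  apply hμ0
  ext i
  have := congrFun heq i
  simp only [Pi.add_apply, Pi.smul_apply, smul_eq_mul] at this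
  have h3 : ε * μ i = 0 := by linarith
  simpa [hε'.ne'] using h3

/-- A finite set of vectors carrying weights in `[0, 1]` of total mass `|S| - d` for which the
weighted sum vanishes. -/
def IsSteinitzSet {ι E : Type*} [AddCommGroup E] [Module ℝ E] (v : ι → E) (d : ℕ)
    (S : Finset ι) : Prop :=
  ∃ w : ι → ℝ, (∀ i, w i ∈ Set.Icc (0 : ℝ) 1) ∧ ∑ i ∈ S, w i = ((S.card - d : ℕ) : ℝ) ∧
    ∑ i ∈ S, w i • v i = 0

lemma IsSteinitzSet.norm_sum_le {ι E : Type*} [NormedAddCommGroup E] [NormedSpace ℝ E]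
    {v : ι → E} {d : ℕ} {S : Finset ι} (hS : IsSteinitzSet v d S) {C : ℝ} (hC : 0 ≤ C)
    (hv : ∀ i, ‖v i‖ ≤ C) : ‖∑ i ∈ S, v i‖ ≤ d * C := by
  obtain ⟨w, hw, hsum, hzero⟩ := hS
  have h1 : ∑ i ∈ S, v i = ∑ i ∈ S, (1 - w i) • v i := by
    simp [sub_smul, Finset.sum_sub_distrib, hzero]
  have h2 : ∑ i ∈ S, (1 - w i) ≤ (d : ℝ) := by
    rw [Finset.sum_sub_distrib, hsum]
    have : (S.card : ℝ) ≤ ((S.card - d : ℕ) : ℝ) + d := by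
      exact_mod_cast (by omega : S.card ≤ (S.card - d) + d)
    simp only [Finset.sum_const, nsmul_eq_mul, mul_one]
    linarith
  calc ‖∑ i ∈ S, v i‖ ≤ ∑ i ∈ S, (1 - w i) * C := by
        rw [h1]
        refine norm_sum_le_of_le _ fun i _ => ?_
        rw [norm_smul, Real.norm_of_nonneg (by linarith [(hw i).2])]
        exact mul_le_mul_of_nonneg_left (hv i) (by linarith [(hw i).2])
    _ = (∑ i ∈ S, (1 - w i)) * C := by rw [Finset.sum_mul]
    _ ≤ d * C := mul_le_mul_of_nonneg_right h2 hC

lemma IsSteinitzSet.exists_erase {ι E : Type*} [DecidableEq ι] [NormedAddCommGroup E]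
    [NormedSpace ℝ E] [FiniteDimensional ℝ E] {v : ι → E} {S : Finset ι}
    (hS : IsSteinitzSet v (Module.finrank ℝ E) S) (hne : S.Nonempty) :
    ∃ i ∈ S, IsSteinitzSet v (Module.finrank ℝ E) (S.erase i) := by
  set d := Module.finrank ℝ E with hd
  obtain hle | hlt := le_or_gt S.card d
  · obtain ⟨i, hi⟩ := hne
    refine ⟨i, hi, 0, by simp, ?_, by simp⟩
    have : (S.erase i).card - d = 0 := by rw [Finset.card_erase_of_mem hi]; omega
    simp [this]
  obtain ⟨w, hw, hsum, hzero⟩ := hS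
  set k : ℕ := S.card - 1 - d with hk
  have hcard : S.card = k + 1 + d := by omega
  have hkd : S.card - d = k + 1 := by omega
  rw [hkd] at hsum
  push_cast at hsum
  let L : (S → ℝ) →ₗ[ℝ] E × ℝ :=
    (Fintype.linearCombination ℝ (fun i : S => v i)).prod
      (Fintype.linearCombination ℝ (fun _ : S => (1 : ℝ)))
  have hL : ∀ y, L y = (∑ i, y i • v i, ∑ i, y i) := fun y => by
    simp [L, Fintype.linearCombination_apply]
  set P : Set (S → ℝ) := {y | L y = (0, (k : ℝ)) ∧ ∀ i, y i ∈ Set.Icc (0 : ℝ) 1} with hP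
  have hPne : P.Nonempty := by
    have hk0 : (0 : ℝ) ≤ k / (k + 1) := by positivity
    have hk1 : (k : ℝ) / (k + 1) ≤ 1 := by
      rw [div_le_one (by positivity)]; linarith
    refine ⟨fun i => k / (k + 1) * w i, ?_, fun i => ⟨mul_nonneg hk0 (hw i).1,
      mul_le_one₀ hk1 (hw i).1 (hw i).2⟩⟩
    rw [hL]
    have e1 : ∑ i : S, ((k : ℝ) / (k + 1) * w i) • v i = 0 := by
      rw [Finset.sum_coe_sort S fun i => ((k : ℝ) / (k + 1) * w i) • v i]
      simp only [mul_smul]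
      rw [← Finset.smul_sum, hzero, smul_zero]
    have e2 : ∑ i : S, ((k : ℝ) / (k + 1) * w i) = k := by
      rw [Finset.sum_coe_sort S fun i => (k : ℝ) / (k + 1) * w i, ← Finset.mul_sum, hsum]
      field_simp
    rw [e1, e2]
  have hPc : IsCompact P := by
    have hbox : IsCompact (Set.univ.pi fun _ : S => Set.Icc (0 : ℝ) 1) :=
      isCompact_univ_pi fun _ => isCompact_Icc
    have hcl : IsClosed {y : S → ℝ | L y = (0, (k : ℝ))} :=
      isClosed_eq L.continuous_of_finiteDimensional continuous_const
    have : P = (Set.univ.pi fun _ : S => Set.Icc (0 : ℝ) 1) ∩ {y | L y = (0, (k : ℝ))} := by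
      ext y
      simp only [hP, Set.mem_ofPred_eq, Set.mem_inter_iff, Set.mem_univ_pi]
      tauto
    rw [this]
    exact hbox.inter_right hcl
  obtain ⟨y, hy⟩ := hPc.extremePoints_nonempty hPne
  have hyL := hy.1.1
  rw [hL, Prod.mk.injEq] at hyL
  have hyI := hy.1.2
  obtain ⟨i, hi⟩ : ∃ i, y i = 0 := by
    by_contra! hno
    have hpos : ∀ i, 0 < y i := fun i => lt_of_le_of_ne (hyI i).1 (hno i).symm
    set I : Finset S := Finset.univ.filter fun i => y i < 1 with hI
    have hIc : I.card ≤ d + 1 := by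
      have := card_interior_coords_le_finrank L _ _ y hy I fun i hi =>
        Icc_mem_nhds (hpos i) (by simpa [hI] using hi)
      simpa [Module.finrank_prod] using this
    have hs : ∑ i ∈ I, (1 - y i) = d + 1 := by
      have h1 : ∑ i ∈ I, (1 - y i) = ∑ i, (1 - y i) := by
        refine Finset.sum_subset (Finset.subset_univ _) fun i _ hi => ?_
        have : ¬ y i < 1 := by simpa [hI] using hi
        linarith [(hyI i).2]
      rw [h1, Finset.sum_sub_distrib, hyL.2]
      simp only [Finset.sum_const, Finset.card_univ, Fintype.card_coe, hcard, nsmul_eq_mul]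
      push_cast
      ring
    obtain h0 | h0 := I.eq_empty_or_nonempty
    · rw [h0, Finset.sum_empty] at hs
      linarith [(Nat.cast_nonneg d : (0 : ℝ) ≤ d)]
    · have h2 : ∑ i ∈ I, (1 - y i) < ∑ i ∈ I, (1 : ℝ) :=
        Finset.sum_lt_sum_of_nonempty h0 fun i _ => by linarith [hpos i]
      rw [hs, Finset.sum_const, nsmul_eq_mul, mul_one] at h2
      have : d + 1 < I.card := by exact_mod_cast h2
      omega
  refine ⟨i, i.2, fun j => if h : j ∈ S then y ⟨j, h⟩ else 0, fun j => ?_, ?_, ?_⟩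
  · by_cases h : j ∈ S
    · simpa [h] using hyI ⟨j, h⟩
    · simp [h]
  · rw [Finset.card_erase_of_mem i.2, Finset.sum_erase _ (by simp [hi]), ← hyL.2,
      ← Finset.sum_coe_sort S]
    simp
  · rw [Finset.sum_erase _ (by simp [hi]), ← hyL.1, ← Finset.sum_coe_sort S]
    simp

lemma IsSteinitzSet.exists_chain {ι E : Type*} [DecidableEq ι] [NormedAddCommGroup E]
    [NormedSpace ℝ E] [FiniteDimensional ℝ E] {v : ι → E} (N : ℕ) (S : Finset ι) (hN : S.card = N)
    (hS : IsSteinitzSet v (Module.finrank ℝ E) S) :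
    ∃ c : ℕ → Finset ι, Monotone c ∧ (∀ i ≤ N, (c i).card = i) ∧
      ∀ i, c i ⊆ S ∧ IsSteinitzSet v (Module.finrank ℝ E) (c i) := by
  induction N generalizing S with
  | zero =>
    exact ⟨fun _ => S, monotone_const, fun i hi => by simp; omega,
      fun i => ⟨subset_rfl, hS⟩⟩
  | succ N ih =>
    obtain ⟨a, ha, hSa⟩ := hS.exists_erase (Finset.card_pos.1 (by omega))
    obtain ⟨c, hmono, hcard, hc⟩ := ih (S.erase a) (by rw [Finset.card_erase_of_mem ha]; omega) hSa
    refine ⟨fun i => if i ≤ N then c i else S, fun i j hij => ?_, fun i hi => ?_, fun i => ?_⟩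
    · dsimp only
      split_ifs with h1 h2
      · exact hmono hij
      · exact (hc i).1.trans (Finset.erase_subset _ _)
      · omega
      · exact le_rfl
    · dsimp only
      split_ifs with h1
      · exact hcard i h1
      · omega
    · dsimp only
      split_ifs with h1
      · exact ⟨(hc i).1.trans (Finset.erase_subset _ _), (hc i).2⟩
      · exact ⟨subset_rfl, hS⟩

/-- **Steinitz lemma**: vectors of norm at most `C` summing to zero can be ordered so that all
partial sums have norm at most `dim E * C`; the ordering is given as a chain of finite sets. -/
theorem exists_steinitz_chain {ι E : Type*} [Fintype ι] [NormedAddCommGroup E]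
    [NormedSpace ℝ E] [FiniteDimensional ℝ E] (v : ι → E) {C : ℝ} (hC : 0 ≤ C)
    (hv : ∀ i, ‖v i‖ ≤ C) (hsum : ∑ i, v i = 0) :
    ∃ c : ℕ → Finset ι, Monotone c ∧ (∀ i ≤ Fintype.card ι, (c i).card = i) ∧
      ∀ i, ‖∑ j ∈ c i, v j‖ ≤ Module.finrank ℝ E * C := by
  classical
  have huniv : IsSteinitzSet v (Module.finrank ℝ E) Finset.univ := by
    set N := (Finset.univ : Finset ι).card with hN
    set d := Module.finrank ℝ E
    refine ⟨fun _ => ((N - d : ℕ) : ℝ) / N, fun _ => ⟨by positivity, ?_⟩, ?_, ?_⟩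
    · exact div_le_one_of_le₀ (by exact_mod_cast Nat.sub_le _ _) (by positivity)
    · rw [Finset.sum_const, nsmul_eq_mul, ← hN]
      rcases Nat.eq_zero_or_pos N with h | h
      · simp [h]
      · have : (N : ℝ) ≠ 0 := by positivity
        field_simp
    · rw [← Finset.smul_sum, hsum, smul_zero]
  obtain ⟨c, hmono, hcard, hc⟩ := huniv.exists_chain _ _ rfl
  exact ⟨c, hmono, hcard, fun i => (hc i).2.norm_sum_le hC hv⟩

/-- Among more than `m (2mD + 1) ^ m` vectors in `ℝ ^ m` of sup-norm at most `D` that sum to zero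
and of which at most `m` are not integral, some nonempty family of integral ones sums to zero. -/
theorem exists_integral_zero_sum {ι : Type*} [Fintype ι] {m : ℕ} (hm : 0 < m) (D : ℕ)
    (u : ι → Fin m → ℝ) (hu : ∀ i, ‖u i‖ ≤ D) (hsum : ∑ i, u i = 0) (W : Finset ι)
    (hW : W.card ≤ m) (hintegral : ∀ i ∉ W, ∀ r, ∃ z : ℤ, u i r = z)
    (hN : m * (2 * m * D + 1) ^ m < Fintype.card ι) :
    ∃ T : Finset ι, T.Nonempty ∧ Disjoint T W ∧ ∑ i ∈ T, u i = 0 := by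
  classical
  obtain ⟨c, hmono, hcard, hc⟩ := exists_steinitz_chain u (Nat.cast_nonneg D) hu hsum
  simp only [Module.finrank_fin_fun] at hc
  set p : ℕ → Fin m → ℝ := fun i => ∑ j ∈ c i, u j with hp
  set cnt : ℕ → ℕ := fun i => (c i ∩ W).card with hcnt
  have hcntW : ∀ i, cnt i ≤ W.card := fun i => Finset.card_le_card Finset.inter_subset_right
  have hcmono : ∀ i j, i ≤ j → cnt i ≤ cnt j := fun i j h =>
    Finset.card_le_card (Finset.inter_subset_inter_right (hmono h))
  let lab : ℕ → ℕ × (Fin m → ℤ) := fun i =>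
    (if cnt i = W.card then 0 else cnt i, fun r => ⌊p i r⌋)
  let B : Finset (ℕ × (Fin m → ℤ)) := Finset.range m ×ˢ
    Fintype.piFinset fun _ : Fin m => Finset.Icc (-((m * D : ℕ) : ℤ)) ((m * D : ℕ) : ℤ)
  have hB : B.card = m * (2 * m * D + 1) ^ m := by
    have : (((m * D : ℕ) : ℤ) + 1 - -((m * D : ℕ) : ℤ)).toNat = 2 * m * D + 1 := by
      have h : (((m * D : ℕ) : ℤ) + 1 - -((m * D : ℕ) : ℤ)) = ((2 * m * D + 1 : ℕ) : ℤ) := by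
        push_cast; ring
      rw [h, Int.toNat_natCast]
    simp only [B, Finset.card_product, Finset.card_range, Fintype.card_piFinset, Int.card_Icc,
      this, Finset.prod_const, Finset.card_univ, Fintype.card_fin]
  have hmaps : ∀ i ∈ Finset.range (Fintype.card ι), lab i ∈ B := by
    intro i _
    simp only [lab, B, Finset.mem_product, Finset.mem_range, Fintype.mem_piFinset, Finset.mem_Icc]
    refine ⟨?_, fun r => ?_⟩
    · split_ifs with h
      · exact hm
      · have := hcntW i; omega
    · have h1 : |p i r| ≤ m * D := (norm_le_pi_norm (p i) r).trans (hc i)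
      rw [abs_le] at h1
      constructor
      · rw [Int.le_floor]; push_cast; linarith [h1.1]
      · exact Int.floor_le_iff.2 (by push_cast; linarith [h1.2])
  obtain ⟨i₀, hi₀, j₀, hj₀, hne₀, hlab₀⟩ :=
    Finset.exists_ne_map_eq_of_card_lt_of_maps_to (by rw [hB, Finset.card_range]; exact hN) hmaps
  obtain ⟨i, j, hij, hjN, hlab⟩ : ∃ i j, i < j ∧ j < Fintype.card ι ∧ lab i = lab j := by
    rw [Finset.mem_range] at hi₀ hj₀
    rcases lt_or_gt_of_ne hne₀ with h | h
    · exact ⟨i₀, j₀, h, hj₀, hlab₀⟩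
    · exact ⟨j₀, i₀, h, hi₀, hlab₀.symm⟩
  simp only [lab, Prod.mk.injEq] at hlab
  obtain ⟨hlab1, hlab2⟩ := hlab
  have hsmall : ∀ r, |p j r - p i r| < 1 := fun r =>
    Int.abs_sub_lt_one_of_floor_eq_floor (congrFun hlab2 r).symm
  have hzero : ∀ T : Finset ι, Disjoint T W → (∀ r, |(∑ l ∈ T, u l) r| < 1) →
      ∑ l ∈ T, u l = 0 := by
    intro T hT hs
    funext r
    have : ∃ z : ℤ, (∑ l ∈ T, u l) r = z := by
      choose! g hg using hintegral
      refine ⟨∑ l ∈ T, g l r, ?_⟩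
      rw [Finset.sum_apply]
      push_cast
      exact Finset.sum_congr rfl fun l hl => hg l (Finset.disjoint_left.1 hT hl) r
    obtain ⟨z, hz⟩ := this
    have h1 := hs r
    rw [hz] at h1 ⊢
    have h2 : |z| < 1 := by exact_mod_cast h1
    simp [Int.abs_lt_one_iff.1 h2]
  have hsub := hmono hij.le
  have hsd : ∑ l ∈ c j \ c i, u l = p j - p i := Finset.sum_sdiff_eq_sub hsub
  by_cases heq : cnt i = cnt j
  · have hT : Disjoint (c j \ c i) W := by
      have h1 : c i ∩ W = c j ∩ W :=
        Finset.eq_of_subset_of_card_le (Finset.inter_subset_inter_right hsub) heq.ge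
      rw [Finset.disjoint_left]
      intro l hl hlW
      rw [Finset.mem_sdiff] at hl
      have : l ∈ c i ∩ W := h1 ▸ Finset.mem_inter.2 ⟨hl.1, hlW⟩
      exact hl.2 (Finset.mem_inter.1 this).1
    refine ⟨c j \ c i, ?_, hT, hzero _ hT fun r => by rw [hsd]; exact hsmall r⟩
    rw [← Finset.card_pos, Finset.card_sdiff_of_subset hsub, hcard i (by omega),
      hcard j (by omega)]
    omega
  · have hle := hcmono i j hij.le
    have hjW := hcntW j
    have h01 : cnt i = 0 ∧ cnt j = W.card := by
      split_ifs at hlab1 <;> omega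
    have hi0 : c i ∩ W = ∅ := Finset.card_eq_zero.1 h01.1
    have hjW' : c j ∩ W = W := Finset.eq_of_subset_of_card_le Finset.inter_subset_right h01.2.ge
    have hT : Disjoint (c j \ c i)ᶜ W := by
      rw [Finset.disjoint_left]
      intro l hl hlW
      simp only [Finset.mem_compl, Finset.mem_sdiff, not_and, not_not] at hl
      have h1 : l ∈ c j := (Finset.mem_inter.1 (hjW'.symm ▸ hlW : l ∈ c j ∩ W)).1
      have h2 : l ∈ c i ∩ W := Finset.mem_inter.2 ⟨hl h1, hlW⟩
      simp [hi0] at h2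
    refine ⟨(c j \ c i)ᶜ, ?_, hT, hzero _ hT fun r => ?_⟩
    · rw [← Finset.card_pos, Finset.card_compl, Finset.card_sdiff_of_subset hsub,
        hcard i (by omega), hcard j (by omega)]
      omega
    · have h1 : ∑ l ∈ (c j \ c i)ᶜ, u l = p i - p j := by
        have := Finset.sum_add_sum_compl (c j \ c i) u
        rw [hsum, hsd] at this
        rw [eq_neg_of_add_eq_zero_right this, neg_sub]
      rw [h1, Pi.sub_apply, abs_sub_comm]
      exact hsmall r

/-- A real kernel vector of `A` with at most `m` non-integral coordinates and large `ℓ¹`-norm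
dominates a nonzero integral kernel vector, coordinatewise and with matching signs. -/
theorem exists_integral_cycle {m n : ℕ} (hm : 0 < m) (D : ℕ) (A : Matrix (Fin m) (Fin n) ℤ)
    (hA : ∀ i j, |A i j| ≤ D) (d : Fin n → ℝ)
    (hd : (A.map (Int.cast : ℤ → ℝ)).mulVec d = 0) (F : Finset (Fin n)) (hF : F.card ≤ m)
    (hintegral : ∀ j ∉ F, ∃ z : ℤ, d j = z)
    (hbig : (m : ℝ) * (2 * (m : ℝ) * (D : ℝ) + 1) ^ m < ∑ j, |d j|) :
    ∃ y : Fin n → ℤ, y ≠ 0 ∧ A.mulVec y = 0 ∧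
      ∀ j, (0 ≤ y j ∧ (y j : ℝ) ≤ d j) ∨ (y j ≤ 0 ∧ d j ≤ y j) := by
  classical
  set s : Fin n → ℤ := fun j => if 0 ≤ d j then 1 else -1 with hs
  have hs1 : ∀ j, |s j| = 1 := fun j => by simp only [hs]; split_ifs <;> simp
  have hs0 : ∀ j, s j ≠ 0 := fun j => by simp only [hs]; split_ifs <;> simp
  have hds : ∀ j, d j = s j * |d j| := fun j => by
    simp only [hs]
    split_ifs with h
    · simp [abs_of_nonneg h]
    · simp [abs_of_neg (not_le.1 h)]
  set g : Fin n → ℕ := fun j => ⌊|d j|⌋₊ with hg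
  set f : Fin n → ℝ := fun j => |d j| - g j with hf
  have hf0 : ∀ j, 0 ≤ f j := fun j => sub_nonneg.2 (Nat.floor_le (abs_nonneg _))
  have hf1 : ∀ j, f j ≤ 1 := fun j => by
    have := Nat.lt_floor_add_one |d j|
    simp only [hf, hg]; linarith
  have hfF : ∀ j, j ∉ F → f j = 0 := fun j hj => by
    obtain ⟨z, hz⟩ := hintegral j hj
    have h1 : |d j| = (z.natAbs : ℝ) := by rw [hz, Nat.cast_natAbs, Int.cast_abs]
    simp only [hf, hg, h1, Nat.floor_natCast, sub_self]
  let u : ((j : Fin n) × Fin (g j)) ⊕ F → Fin m → ℝ :=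
    Sum.elim (fun q r => s q.1 * A r q.1) (fun j r => f j * (s j * A r j))
  have habs : ∀ r j, |(s j : ℝ) * A r j| ≤ D := fun r j => by
    have h : |s j * A r j| ≤ (D : ℤ) := by rw [abs_mul, hs1, one_mul]; exact hA r j
    exact_mod_cast h
  have hu : ∀ i, ‖u i‖ ≤ D := by
    intro i
    rw [pi_norm_le_iff_of_nonneg (Nat.cast_nonneg D)]
    intro r
    rcases i with q | j
    · exact habs r q.1
    · simp only [u, Sum.elim_inr, Real.norm_eq_abs]
      rw [abs_mul, abs_of_nonneg (hf0 _)]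
      exact (mul_le_of_le_one_left (abs_nonneg _) (hf1 _)).trans (habs r j)
  have hsum : ∑ i, u i = 0 := by
    funext r
    rw [Finset.sum_apply, Fintype.sum_sum_type, Fintype.sum_sigma]
    simp only [u, Sum.elim_inl, Sum.elim_inr, Finset.sum_const, Finset.card_univ,
      Fintype.card_fin, nsmul_eq_mul, Pi.zero_apply]
    rw [Finset.sum_coe_sort F fun j => f j * ((s j : ℝ) * A r j),
      Finset.sum_subset (Finset.subset_univ F) fun j _ hj => by rw [hfF j hj, zero_mul],
      ← Finset.sum_add_distrib]
    have h := congrFun hd r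
    simp only [Matrix.mulVec, dotProduct, Matrix.map_apply, Pi.zero_apply] at h
    rw [← h]
    refine Finset.sum_congr rfl fun j _ => ?_
    conv_rhs => rw [hds j]
    simp only [hf]
    ring
  let W : Finset (((j : Fin n) × Fin (g j)) ⊕ F) := Finset.univ.map Function.Embedding.inr
  have hcard : Fintype.card (((j : Fin n) × Fin (g j)) ⊕ F) = ∑ j, g j + F.card := by simp
  have hN : m * (2 * m * D + 1) ^ m < Fintype.card (((j : Fin n) × Fin (g j)) ⊕ F) := by
    rw [hcard]
    have h1 : ∑ j, |d j| ≤ ∑ j, (g j : ℝ) + F.card := by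
      have h2 : ∑ j, |d j| = ∑ j, (g j : ℝ) + ∑ j ∈ F, f j := by
        rw [Finset.sum_subset (Finset.subset_univ F) fun j _ hj => hfF j hj,
          ← Finset.sum_add_distrib]
        exact Finset.sum_congr rfl fun j _ => by simp only [hf]; ring
      have h3 : ∑ j ∈ F, f j ≤ F.card := by
        simpa using Finset.sum_le_card_nsmul F f 1 fun j _ => hf1 j
      linarith
    exact_mod_cast hbig.trans_le h1
  obtain ⟨T, hTne, hTW, hT0⟩ := exists_integral_zero_sum hm D u hu hsum W (by simpa [W] using hF)
    (fun i hi r => by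
      rcases i with q | j
      · exact ⟨s q.1 * A r q.1, by simp [u]⟩
      · simp [W] at hi) hN
  have hTr : ∀ j : F, Sum.inr j ∉ T := fun j hj =>
    Finset.disjoint_left.1 hTW hj (by simp [W])
  set t : Fin n → ℕ := fun j =>
    (Finset.univ.filter fun l : Fin (g j) => Sum.inl ⟨j, l⟩ ∈ T).card with ht
  have htg : ∀ j, t j ≤ g j := fun j => by
    simpa using Finset.card_le_univ (Finset.univ.filter fun l : Fin (g j) => Sum.inl ⟨j, l⟩ ∈ T)
  have htd : ∀ j, (t j : ℝ) ≤ |d j| := fun j => by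
    have : (t j : ℝ) ≤ g j := by exact_mod_cast htg j
    linarith [hf0 j]
  refine ⟨fun j => s j * t j, ?_, ?_, fun j => ?_⟩
  · obtain ⟨i, hi⟩ := hTne
    rcases i with q | j
    · intro h0
      have h1 := congrFun h0 q.1
      have h2 : t q.1 = 0 := by simpa [hs0] using h1
      have h3 := Finset.card_eq_zero.1 h2
      have h4 : q.2 ∈ Finset.univ.filter fun l : Fin (g q.1) => Sum.inl ⟨q.1, l⟩ ∈ T := by
        simpa using hi
      simp [h3] at h4
    · exact absurd hi (hTr j)
  · funext r
    have h := congrFun hT0 r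
    have h1 : (∑ i ∈ T, u i) r = ∑ i, if i ∈ T then u i r else 0 := by
      rw [Finset.sum_apply, Finset.sum_ite_mem, Finset.univ_inter]
    rw [h1, Fintype.sum_sum_type, Fintype.sum_sigma] at h
    simp only [hTr, if_false, Finset.sum_const_zero, add_zero, u, Sum.elim_inl,
      ← Finset.sum_filter, Finset.sum_const, nsmul_eq_mul, Pi.zero_apply] at h
    have h2 : ∑ j, (t j : ℤ) * (s j * A r j) = 0 := by exact_mod_cast h
    rw [Pi.zero_apply, ← h2]
    simp only [Matrix.mulVec, dotProduct]
    exact Finset.sum_congr rfl fun j _ => by ring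
  · have h1 := hds j
    have h2 := htd j
    simp only [hs] at h1 ⊢
    split_ifs at h1 ⊢ with h
    · left; rw [abs_of_nonneg h] at h2; simpa using h2
    · right; rw [abs_of_neg (not_le.1 h)] at h2
      push_cast
      exact ⟨by simp, by linarith⟩

/-- Proximity theorem (Theorem 3.3 in Eisenbrand–Weismantel): given a feasible integer
program `max {cᵀx : Ax = b, x ≥ 0, x ∈ ℤⁿ}` with `‖A‖∞ ≤ Δ`, and an optimal vertex
solution `x*` of its LP relaxation, there is an optimal integer solution `z*` with
`‖z* − x*‖₁ ≤ m (2mΔ + 1)^m`. -/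
theorem proximity_theorem (m n : ℕ) (hm : 0 < m) (hn : 0 < n) (Δ : ℤ)
    (A : Matrix (Fin m) (Fin n) ℤ) (hΔ : ∀ i j, |A i j| ≤ Δ)
    (b : Fin m → ℤ) (c : Fin n → ℤ)
    -- the integer program is feasible
    (x0 : Fin n → ℤ) (hx0nonneg : 0 ≤ x0) (hx0 : A.mulVec x0 = b)
    -- `x*` is a feasible point of the LP relaxation
    (xstar : Fin n → ℝ)
    (hxstar : xstar ∈ {y : Fin n → ℝ |
      (A.map (Int.cast : ℤ → ℝ)).mulVec y = (fun i => (b i : ℝ)) ∧ 0 ≤ y})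
    -- `x*` is optimal for the LP relaxation
    (hopt : ∀ y ∈ {y : Fin n → ℝ |
        (A.map (Int.cast : ℤ → ℝ)).mulVec y = (fun i => (b i : ℝ)) ∧ 0 ≤ y},
      (fun i => (c i : ℝ)) ⬝ᵥ y ≤ (fun i => (c i : ℝ)) ⬝ᵥ xstar)
    -- `x*` is an extreme point (vertex) of the LP feasible region
    (hvertex : xstar ∈ Set.extremePoints ℝ {y : Fin n → ℝ |
      (A.map (Int.cast : ℤ → ℝ)).mulVec y = (fun i => (b i : ℝ)) ∧ 0 ≤ y}) :
    ∃ z : Fin n → ℤ, 0 ≤ z ∧ A.mulVec z = b ∧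
      (∀ y : Fin n → ℤ, 0 ≤ y → A.mulVec y = b → c ⬝ᵥ y ≤ c ⬝ᵥ z) ∧
      ∑ i, |(z i : ℝ) - xstar i| ≤ (m : ℝ) * (2 * (m : ℝ) * (Δ : ℝ) + 1) ^ m := by
  classical
  have hΔ0 : 0 ≤ Δ := (abs_nonneg _).trans (hΔ ⟨0, hm⟩ ⟨0, hn⟩)
  lift Δ to ℕ using hΔ0
  have hxn : ∀ j, 0 ≤ xstar j := fun j => hxstar.2 j
  have hcast : ∀ y : Fin n → ℤ, A.mulVec y = b →
      (A.map (Int.cast : ℤ → ℝ)).mulVec (fun j => (y j : ℝ)) = fun i => (b i : ℝ) := by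
    rintro y rfl
    funext i
    simp [Matrix.mulVec, dotProduct]
  have hcdot : ∀ y : Fin n → ℤ,
      (fun i => (c i : ℝ)) ⬝ᵥ (fun j => (y j : ℝ)) = ((c ⬝ᵥ y : ℤ) : ℝ) := fun y => by
    simp [dotProduct]
  obtain ⟨M, ⟨z₀, hz₀, hz₀A, rfl⟩, hM⟩ :=
    Int.exists_greatest_of_bdd (P := fun v => ∃ y : Fin n → ℤ, 0 ≤ y ∧ A.mulVec y = b ∧ c ⬝ᵥ y = v)
      ⟨⌊(fun i => (c i : ℝ)) ⬝ᵥ xstar⌋, by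
        rintro v ⟨y, hy, hyA, rfl⟩
        rw [Int.le_floor, ← hcdot]
        exact hopt _ ⟨hcast y hyA, fun j => Int.cast_nonneg (hy j)⟩⟩
      ⟨_, x0, hx0nonneg, hx0, rfl⟩
  let dist : (Fin n → ℤ) → ℝ := fun z => ∑ i, |(z i : ℝ) - xstar i|
  obtain ⟨z, ⟨hz, hzA, hzc⟩, hmin⟩ := (measure fun z => ⌊dist z⌋₊).wf.has_min
    {z | 0 ≤ z ∧ A.mulVec z = b ∧ c ⬝ᵥ z = c ⬝ᵥ z₀} ⟨z₀, hz₀, hz₀A, rfl⟩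
  refine ⟨z, hz, hzA, fun y hy hyA => hzc ▸ hM _ ⟨y, hy, hyA, rfl⟩, ?_⟩
  by_contra! hbig
  set F : Finset (Fin n) := Finset.univ.filter fun j => xstar j ≠ 0 with hF
  have hFcard : F.card ≤ m := by
    have h := card_interior_coords_le_finrank (Matrix.mulVecLin (A.map (Int.cast : ℤ → ℝ)))
      (fun i => (b i : ℝ)) (fun _ => Set.Ici 0) xstar
      (by simpa only [Matrix.mulVecLin_apply, Set.mem_Ici, Pi.le_def, Pi.zero_apply] using hvertex)
      F (fun j hj => Ici_mem_nhds (lt_of_le_of_ne (hxn j) (by simpa [hF, eq_comm] using hj)))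
    simpa using h
  obtain ⟨y, hy0, hyA, hy⟩ := exists_integral_cycle hm Δ A hΔ (fun j => (z j : ℝ) - xstar j)
    (by
      have := hcast z hzA
      have h2 := hxstar.1
      change (A.map (Int.cast : ℤ → ℝ)).mulVec ((fun j => (z j : ℝ)) - xstar) = 0
      rw [Matrix.mulVec_sub, this, h2, sub_self])
    F hFcard (fun j hj => ⟨z j, by
      have : xstar j = 0 := by simpa [hF] using hj
      simp [this]⟩) (by exact_mod_cast hbig)
  have hzn : ∀ j, 0 ≤ z j := fun j => hz j
  have hznR : ∀ j, (0 : ℝ) ≤ z j := fun j => by exact_mod_cast hz j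
  have hyA' : (A.map (Int.cast : ℤ → ℝ)).mulVec (fun j => (y j : ℝ)) = 0 := by
    funext i
    have h := congrFun hyA i
    simp only [Matrix.mulVec, dotProduct, Pi.zero_apply, Matrix.map_apply] at h ⊢
    exact_mod_cast h
  have hxy := hopt (xstar + fun j => (y j : ℝ)) ⟨by
    rw [Matrix.mulVec_add, hyA', hxstar.1, add_zero], fun j => by
      simp only [Pi.zero_apply, Pi.add_apply]
      rcases hy j with ⟨h1, h2⟩ | ⟨h1, h2⟩
      · have : (0 : ℝ) ≤ y j := by exact_mod_cast h1
        linarith [hxn j]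
      · linarith [hznR j]⟩
  rw [dotProduct_add, hcdot] at hxy
  have hcy : c ⬝ᵥ y ≤ 0 := by
    have : ((c ⬝ᵥ y : ℤ) : ℝ) ≤ 0 := by linarith
    exact_mod_cast this
  have hzy : 0 ≤ z - y := fun j => by
    simp only [Pi.zero_apply, Pi.sub_apply]
    rcases hy j with ⟨h1, h2⟩ | ⟨h1, h2⟩
    · have : (y j : ℝ) ≤ z j := by linarith [hxn j]
      have : y j ≤ z j := by exact_mod_cast this
      omega
    · have := hzn j
      omega
  have hzyA : A.mulVec (z - y) = b := by rw [Matrix.mulVec_sub, hyA, hzA, sub_zero]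
  have hle := hM _ ⟨z - y, hzy, hzyA, rfl⟩
  have hczy : c ⬝ᵥ (z - y) = c ⬝ᵥ z₀ := by
    rw [dotProduct_sub] at hle ⊢
    omega
  have hdec : dist (z - y) + 1 ≤ dist z := by
    have h1 : dist (z - y) + ∑ j, |(y j : ℝ)| = dist z := by
      simp only [dist, ← Finset.sum_add_distrib]
      refine Finset.sum_congr rfl fun j _ => ?_
      simp only [Pi.sub_apply, Int.cast_sub]
      rcases hy j with ⟨h1, h2⟩ | ⟨h1, h2⟩
      · have h3 : (0 : ℝ) ≤ y j := by exact_mod_cast h1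
        rw [abs_of_nonneg h3, abs_of_nonneg (by linarith), abs_of_nonneg (by linarith)]
        ring
      · have h3 : (y j : ℝ) ≤ 0 := by exact_mod_cast h1
        rw [abs_of_nonpos h3, abs_of_nonpos (by linarith), abs_of_nonpos (by linarith)]
        ring
    obtain ⟨j, hj⟩ := Function.ne_iff.1 hy0
    have h2 : (1 : ℝ) ≤ |(y j : ℝ)| := by exact_mod_cast Int.one_le_abs hj
    have h3 := Finset.single_le_sum (f := fun j => |(y j : ℝ)|) (fun j _ => abs_nonneg _)
      (Finset.mem_univ j)
    linarith
  have hnn : 0 ≤ dist (z - y) := Finset.sum_nonneg fun _ _ => abs_nonneg _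
  have h1 : ⌊dist (z - y)⌋₊ + 1 ≤ ⌊dist z⌋₊ := by
    rw [← Nat.floor_add_one hnn]
    exact Nat.floor_le_floor hdec
  exact hmin (z - y) ⟨hzy, hzyA, hczy⟩ h1
end

section
/- Let W be an m×n integer matrix of rank m with all entries of absolute value at most Δ, and let B ⊆ {1,…,n} be a set of m indices such that the columns of W indexed by B are linearly independent; write W_B for the m×m submatrix of these columns. Let b ∈ cone(W_B) ∩ ℤ^m. Then b ∈ intcone(W) if and only if there exists v ∈ intcone(W) with ‖v‖_∞ ≤ Δ·m·(2mΔ + 1)^m such that b − v ∈ intcone(W_B). -/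
open Matrix

lemma exists_mem_Icc_card_le_finrank {ι E : Type*} [Fintype ι] [NormedAddCommGroup E]
    [NormedSpace ℝ E] [FiniteDimensional ℝ E] (v : ι → E) {a w c : ι → ℝ} (hc : c ∈ Set.Icc a w) :
    ∃ c' ∈ Set.Icc a w, ∑ i, c' i • v i = ∑ i, c i • v i ∧
      Fintype.card {i // a i < c' i ∧ c' i < w i} ≤ Module.finrank ℝ E := by
  classical
  let P : Set (ι → ℝ) := Set.Icc a w ∩ {c' | ∑ i, c' i • v i = ∑ i, c i • v i}
  have hP : IsCompact P := by
    refine isCompact_Icc.inter_right (isClosed_eq ?_ continuous_const)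
    fun_prop
  obtain ⟨e, ⟨heI, heS⟩, hext⟩ := hP.extremePoints_nonempty ⟨c, hc, rfl⟩
  refine ⟨e, heI, heS, ?_⟩
  by_contra! hcard
  have hdep : ¬ LinearIndependent ℝ (fun i : {i // a i < e i ∧ e i < w i} => v i) :=
    fun h => hcard.not_ge h.fintype_card_le_finrank
  obtain ⟨g, hg, ⟨i₀, hi₀⟩, hne⟩ := Fintype.not_linearIndependent_iff.1 hdep
  let r : ι → ℝ := fun i => if h : a i < e i ∧ e i < w i then g ⟨i, h⟩ else 0
  have hr : ∑ i, r i • v i = 0 := by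
    rw [← hg]
    symm
    apply Finset.sum_of_injOn (fun i => i.1) Subtype.val_injective.injOn (by simp)
    · intro i _ hi
      have : ¬ (a i < e i ∧ e i < w i) := by
        intro h
        exact hi ⟨⟨i, h⟩, by simp⟩
      simp [r, this]
    · intro i _
      simp [r, i.2]
  have hev : ∀ᶠ t : ℝ in nhds 0, ∀ i, a i < e i ∧ e i < w i →
      a i < e i + t * r i ∧ e i + t * r i < w i := by
    rw [Filter.eventually_all]
    intro i
    by_cases h : a i < e i ∧ e i < w i
    · have hcont : Filter.Tendsto (fun t : ℝ => e i + t * r i) (nhds 0) (nhds (e i)) := by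
        have : Continuous (fun t : ℝ => e i + t * r i) := by fun_prop
        simpa using this.tendsto 0
      filter_upwards [hcont.eventually (Ioo_mem_nhds h.1 h.2)] with t ht _
      exact ht
    · exact Filter.Eventually.of_forall fun t h' => absurd h' h
  obtain ⟨δ, hδ, hball⟩ := Metric.eventually_nhds_iff.1 hev
  have hmem : ∀ t : ℝ, |t| < δ → e + t • r ∈ P := by
    intro t ht
    have hb := hball (y := t) (by simpa using ht)
    have key : ∀ i, a i ≤ e i + t * r i ∧ e i + t * r i ≤ w i := by
      intro i
      by_cases h : a i < e i ∧ e i < w i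
      · exact ⟨(hb i h).1.le, (hb i h).2.le⟩
      · have : r i = 0 := by simp only [r, dif_neg h]
        simpa [this] using And.intro (heI.1 i) (heI.2 i)
    refine ⟨⟨fun i => (key i).1, fun i => (key i).2⟩, ?_⟩
    have hS : ∑ i, e i • v i = ∑ i, c i • v i := heS
    simp only [Set.mem_ofPred_eq, Pi.add_apply, Pi.smul_apply, smul_eq_mul, add_smul,
      Finset.sum_add_distrib, mul_smul]
    rw [← Finset.smul_sum, hr, hS]
    simp
  have hδ2 : |δ / 2| < δ := by rw [abs_of_pos (by linarith)]; linarith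
  have h1 := hmem (δ / 2) hδ2
  have h2 := hmem (-(δ / 2)) (by simpa using hδ2)
  have heq := hext h1 h2 ⟨1 / 2, 1 / 2, by norm_num, by norm_num, by norm_num, by
    ext i; simp; ring⟩
  have := congrFun heq i₀
  simp [r, hi₀, hδ.ne', hne] at this

lemma exists_erase_fractional_zero_sum {ι E : Type*} [Fintype ι] [DecidableEq ι]
    [NormedAddCommGroup E] [NormedSpace ℝ E] [FiniteDimensional ℝ E] (u : ι → E) {S : Finset ι}
    {k : ℕ} (hS : S.card = k + 1) (hk : Module.finrank ℝ E ≤ k) {c : ι → ℝ}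
    (hc : c ∈ Set.Icc 0 (fun i => if i ∈ S then (1 : ℝ) else 0)) (hu : ∑ i, c i • u i = 0)
    (hsum : ∑ i, c i = (k + 1 : ℕ) - (Module.finrank ℝ E : ℝ)) :
    ∃ a ∈ S, ∃ c' ∈ Set.Icc (0 : ι → ℝ) (fun i => if i ∈ S.erase a then (1 : ℝ) else 0),
      ∑ i, c' i • u i = 0 ∧ ∑ i, c' i = (k : ℝ) - (Module.finrank ℝ E : ℝ) := by
  set d := Module.finrank ℝ E with hd
  have hkd : (d : ℝ) ≤ k := by exact_mod_cast hk
  have hpos : (0 : ℝ) < (k : ℝ) + 1 - d := by linarith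
  let t : ℝ := (k - d) / (k + 1 - d)
  have ht0 : 0 ≤ t := div_nonneg (by linarith) hpos.le
  have ht1 : t ≤ 1 := (div_le_one hpos).2 (by linarith)
  have htc : t • c ∈ Set.Icc 0 (fun i => if i ∈ S then (1 : ℝ) else 0) := by
    refine ⟨fun i => mul_nonneg ht0 (hc.1 i), fun i => ?_⟩
    exact (mul_le_of_le_one_left (hc.1 i) ht1).trans (hc.2 i)
  obtain ⟨e, he, heS, hcard⟩ :=
    exists_mem_Icc_card_le_finrank (fun i => ((u i, 1) : E × ℝ)) htc
  have he1 : ∑ i, e i • u i = 0 := by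
    have := congrArg Prod.fst heS
    simp only [Prod.fst_sum, Prod.smul_fst, Pi.smul_apply, smul_assoc] at this
    rw [this, ← Finset.smul_sum, hu, smul_zero]
  have he2 : ∑ i, e i = (k : ℝ) - d := by
    have := congrArg Prod.snd heS
    simp only [Prod.snd_sum, Prod.smul_snd, Pi.smul_apply, smul_eq_mul, mul_one] at this
    rw [this, ← Finset.mul_sum, hsum]
    push_cast
    exact div_mul_cancel₀ _ hpos.ne'
  have hout : ∀ i ∉ S, e i = 0 := fun i hi =>
    le_antisymm (by simpa [hi] using he.2 i) (he.1 i)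
  have hzero : ∃ a ∈ S, e a = 0 := by
    by_contra! hne
    have hposS : ∀ i ∈ S, 0 < e i := fun i hi => lt_of_le_of_ne (he.1 i) (hne i hi).symm
    have hleS : ∀ i ∈ S, e i ≤ 1 := fun i hi => by simpa [hi] using he.2 i
    have hF : (S.filter fun i => e i < 1).card ≤ d + 1 := by
      have hfr : Module.finrank ℝ (E × ℝ) = d + 1 := by simp [hd]
      rw [hfr, Fintype.card_subtype] at hcard
      refine (Finset.card_le_card ?_).trans hcard
      intro i hi
      rw [Finset.mem_filter] at hi
      simp [hposS i hi.1, hi.1, hi.2]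
    have hsumS : ∑ i ∈ S, e i = (k : ℝ) - d := by
      rw [← he2]
      exact Finset.sum_subset (Finset.subset_univ _) fun i _ hi => hout i hi
    rw [← Finset.sum_filter_add_sum_filter_not S (fun i => e i < 1)] at hsumS
    have hones : ∑ i ∈ S.filter (fun i => ¬ e i < 1), e i
        = (S.filter (fun i => ¬ e i < 1)).card := by
      rw [Finset.card_eq_sum_ones, Nat.cast_sum]
      refine Finset.sum_congr rfl fun i hi => ?_
      rw [Finset.mem_filter] at hi
      have := hleS i hi.1
      push_cast
      linarith [not_lt.1 hi.2]
    have hcc := Finset.card_filter_add_card_filter_not (s := S) (fun i => e i < 1)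
    have hcc' : ((S.filter fun i => e i < 1).card : ℝ)
        + (S.filter (fun i => ¬ e i < 1)).card = k + 1 := by
      rw [hS] at hcc; exact_mod_cast hcc
    have hF' : ((S.filter fun i => e i < 1).card : ℝ) ≤ d + 1 := by exact_mod_cast hF
    rcases (S.filter fun i => e i < 1).eq_empty_or_nonempty with h0 | h0
    · rw [h0] at hsumS hcc'
      simp only [Finset.sum_empty, Finset.card_empty, Nat.cast_zero, zero_add] at hsumS hcc'
      linarith [Nat.cast_nonneg (α := ℝ) d]
    · have := Finset.sum_pos (fun i hi => hposS i (Finset.mem_filter.1 hi).1) h0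
      linarith
  obtain ⟨a, ha, hea⟩ := hzero
  refine ⟨a, ha, e, ⟨he.1, fun i => ?_⟩, he1, he2⟩
  by_cases hia : i = a
  · simp [hia, hea]
  · simpa [hia] using he.2 i

/-- The Steinitz lemma, with the rearrangement given as a chain of initial segments. -/
lemma exists_chain_norm_sum_le {ι E : Type*} [Fintype ι] [NormedAddCommGroup E]
    [NormedSpace ℝ E] [FiniteDimensional ℝ E] (u : ι → E) {Δ : ℝ} (hΔ : 0 ≤ Δ)
    (hu : ∀ i, ‖u i‖ ≤ Δ) (hsum : ∑ i, u i = 0) :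
    ∃ A : ℕ → Finset ι, Monotone A ∧ (∀ k ≤ Fintype.card ι, (A k).card = k) ∧
      ∀ k, ‖∑ i ∈ A k, u i‖ ≤ Module.finrank ℝ E * Δ := by
  classical
  set d := Module.finrank ℝ E with hd
  have chain : ∀ k : ℕ, ∀ S : Finset ι, S.card = k →
      (k ≤ d ∨ ∃ c ∈ Set.Icc (0 : ι → ℝ) (fun i => if i ∈ S then (1 : ℝ) else 0),
        ∑ i, c i • u i = 0 ∧ ∑ i, c i = (k : ℝ) - d) →
      ∃ A : ℕ → Finset ι, Monotone A ∧ (∀ j, A j ⊆ S) ∧ (∀ j ≤ k, (A j).card = j) ∧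
        ∀ j, ‖∑ i ∈ A j, u i‖ ≤ d * Δ := by
    intro k
    induction k with
    | zero =>
      intro S _ _
      refine ⟨fun _ => ∅, monotone_const, by simp, by simp, fun j => ?_⟩
      simp only [Finset.sum_empty, norm_zero]
      positivity
    | succ k ih =>
      intro S hS hP
      have hbound : ‖∑ i ∈ S, u i‖ ≤ d * Δ := by
        rcases hP with hk | ⟨c, hc, hcu, hcs⟩
        · calc ‖∑ i ∈ S, u i‖ ≤ S.card • Δ := by
                rw [← Finset.sum_const]
                exact norm_sum_le_of_le _ fun i _ => hu i
            _ ≤ d * Δ := by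
                rw [nsmul_eq_mul, hS]
                gcongr
        · have hout : ∀ i ∉ S, c i = 0 := fun i hi =>
            le_antisymm (by simpa [hi] using hc.2 i) (hc.1 i)
          have hle : ∀ i ∈ S, c i ≤ 1 := fun i hi => by simpa [hi] using hc.2 i
          have h1 : ∑ i ∈ S, c i • u i = 0 := by
            rw [← hcu]
            exact Finset.sum_subset (Finset.subset_univ _) fun i _ hi => by simp [hout i hi]
          have h2 : ∑ i ∈ S, c i = (k + 1 : ℕ) - (d : ℝ) := by
            rw [← hcs]
            exact Finset.sum_subset (Finset.subset_univ _) fun i _ hi => hout i hi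
          calc ‖∑ i ∈ S, u i‖ = ‖∑ i ∈ S, (1 - c i) • u i‖ := by
                simp [sub_smul, Finset.sum_sub_distrib, h1]
            _ ≤ ∑ i ∈ S, (1 - c i) * Δ := by
                refine norm_sum_le_of_le _ fun i hi => ?_
                have := hle i hi
                rw [norm_smul, Real.norm_of_nonneg (by linarith)]
                exact mul_le_mul_of_nonneg_left (hu i) (by linarith)
            _ = d * Δ := by
                rw [← Finset.sum_mul, Finset.sum_sub_distrib, h2]
                simp [hS]
      obtain ⟨a, ha, hPa⟩ : ∃ a ∈ S, (k ≤ d ∨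
          ∃ c ∈ Set.Icc (0 : ι → ℝ) (fun i => if i ∈ S.erase a then (1 : ℝ) else 0),
            ∑ i, c i • u i = 0 ∧ ∑ i, c i = (k : ℝ) - d) := by
        by_cases hk : k ≤ d
        · obtain ⟨a, ha⟩ := Finset.card_pos.1 (by omega : 0 < S.card)
          exact ⟨a, ha, Or.inl hk⟩
        · rcases hP with hk' | ⟨c, hc, hcu, hcs⟩
          · omega
          · obtain ⟨a, ha, h⟩ := exists_erase_fractional_zero_sum u hS (by omega) hc hcu hcs
            exact ⟨a, ha, Or.inr h⟩
      obtain ⟨A, hmono, hsub, hcard, hA⟩ :=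
        ih (S.erase a) (by rw [Finset.card_erase_of_mem ha]; omega) hPa
      have hsubS : ∀ j, A j ⊆ S := fun j => (hsub j).trans (Finset.erase_subset _ _)
      refine ⟨fun j => if j ≤ k then A j else S, ?_, ?_, ?_, ?_⟩
      · intro i j hij
        dsimp only
        split_ifs with h1 h2
        · exact hmono hij
        · exact hsubS i
        · omega
        · exact le_rfl
      · intro j
        dsimp only
        split_ifs
        · exact hsubS j
        · exact subset_rfl
      · intro j hj
        dsimp only
        split_ifs with h
        · exact hcard j h
        · omega
      · intro j
        dsimp only
        split_ifs
        · exact hA j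
        · exact hbound
  obtain ⟨A, hmono, -, hcard, hA⟩ := chain (Fintype.card ι) Finset.univ rfl (by
    by_cases hk : Fintype.card ι ≤ d
    · exact Or.inl hk
    · have hk' : (d : ℝ) < Fintype.card ι := by exact_mod_cast not_le.1 hk
      have hpos : (0 : ℝ) < Fintype.card ι := lt_of_le_of_lt (Nat.cast_nonneg d) hk'
      refine Or.inr ⟨fun _ => (Fintype.card ι - d) / Fintype.card ι, ⟨fun i => ?_, fun i => ?_⟩,
        ?_, ?_⟩
      · exact div_nonneg (by linarith) hpos.le
      · simp only [Finset.mem_univ, if_true]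
        exact (div_le_one hpos).2 (by linarith [Nat.cast_nonneg (α := ℝ) d])
      · rw [← Finset.smul_sum, hsum, smul_zero]
      · rw [Finset.sum_const, Finset.card_univ, nsmul_eq_mul]
        exact mul_div_cancel₀ _ hpos.ne')
  exact ⟨A, hmono, hcard, hA⟩

lemma exists_nonempty_zero_sum {ι : Type*} [Fintype ι] {m : ℕ} (hm : 0 < m) {Δ : ℤ}
    (hΔ : 0 ≤ Δ) (g : ι → Fin m → ℤ) (hg : ∀ l i, |g l i| ≤ Δ) (h : Fin m → Fin m → ℝ)
    (hh : ∀ l i, |h l i| ≤ Δ) (hsum : ∀ i, ∑ l, (g l i : ℝ) + ∑ l, h l i = 0)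
    (hcard : (m : ℤ) * (2 * m * Δ + 1) ^ m < Fintype.card ι + m) :
    ∃ C : Finset ι, C.Nonempty ∧ ∀ i, ∑ l ∈ C, g l i = 0 := by
  classical
  have hΔ' : (0 : ℝ) ≤ Δ := by exact_mod_cast hΔ
  let u : ι ⊕ Fin m → Fin m → ℝ := Sum.elim (fun l i => (g l i : ℝ)) h
  have hu : ∀ s, ‖u s‖ ≤ Δ := by
    intro s
    rw [pi_norm_le_iff_of_nonneg hΔ']
    intro i
    rcases s with l | l
    · simpa [u] using (by exact_mod_cast hg l i : |(g l i : ℝ)| ≤ Δ)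
    · simpa [u] using hh l i
  have hu0 : ∑ s, u s = 0 := by
    ext i
    simpa [u, Fintype.sum_sum_type] using hsum i
  obtain ⟨A, hmono, hAcard, hA⟩ := exists_chain_norm_sum_le u hΔ' hu hu0
  have hT : Fintype.card (ι ⊕ Fin m) = Fintype.card ι + m := by simp
  rw [hT] at hAcard
  have hfin : Module.finrank ℝ (Fin m → ℝ) = m := by simp
  let R : ℤ := m * Δ
  have hR : 0 ≤ R := by positivity
  have hcoord : ∀ k i, |∑ s ∈ A k, u s i| ≤ (R : ℝ) := by
    intro k i
    have h1 := (norm_le_pi_norm (∑ s ∈ A k, u s) i).trans (hA k)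
    rw [hfin] at h1
    simpa [R] using h1
  let F : ℕ → ℕ := fun k => (A k).toRight.card
  let key : ℕ → ℕ × (Fin m → ℤ) := fun k => (F k % m, fun i => ⌊∑ s ∈ A k, u s i⌋)
  let K : Finset (ℕ × (Fin m → ℤ)) :=
    Finset.range m ×ˢ Fintype.piFinset fun _ => Finset.Icc (-R) R
  have hK : K.card < (Finset.range (Fintype.card ι + m)).card := by
    have : ((K.card : ℕ) : ℤ) = m * (2 * m * Δ + 1) ^ m := by
      simp only [K, Finset.card_product, Finset.card_range, Fintype.card_piFinset, Int.card_Icc,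
        Finset.prod_const, Finset.card_univ, Fintype.card_fin]
      push_cast
      rw [Int.toNat_of_nonneg (by omega), show R + 1 - -R = 2 * m * Δ + 1 by simp only [R]; ring]
    rw [Finset.card_range]
    zify
    rw [this]
    exact hcard
  have hmaps : ∀ k ∈ Finset.range (Fintype.card ι + m), key k ∈ K := by
    intro k _
    simp only [K, key, Finset.mem_product, Finset.mem_range, Fintype.mem_piFinset, Finset.mem_Icc]
    refine ⟨Nat.mod_lt _ hm, fun i => ⟨?_, ?_⟩⟩
    · rw [Int.le_floor]
      push_cast
      exact (abs_le.1 (hcoord k i)).1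
    · have := (Int.floor_le (∑ s ∈ A k, u s i)).trans (abs_le.1 (hcoord k i)).2
      exact_mod_cast this
  obtain ⟨j, hj, k, hk, hjk, hkey⟩ := Finset.exists_ne_map_eq_of_card_lt_of_maps_to hK hmaps
  wlog hlt : j < k generalizing j k
  · exact this k hk j hj hjk.symm hkey.symm (by omega)
  rw [Finset.mem_range] at hj hk
  set D := A k \ A j with hD
  have hsub : A j ⊆ A k := hmono hlt.le
  have hDcard : D.card = k - j := by
    rw [hD, Finset.card_sdiff_of_subset hsub, hAcard k hk.le, hAcard j hj.le]
  have hDu : ∀ i, ∑ s ∈ D, u s i = ∑ s ∈ A k, u s i - ∑ s ∈ A j, u s i := fun i => by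
    rw [← Finset.sum_sdiff hsub]; ring
  have hDlt : ∀ i, |∑ s ∈ D, u s i| < 1 := fun i => by
    rw [hDu]
    exact Int.abs_sub_lt_one_of_floor_eq_floor (congrFun (congrArg Prod.snd hkey) i).symm
  have hright : m ∣ D.toRight.card := by
    have h1 : F j % m = F k % m := congrArg Prod.fst hkey
    have h2 : D.toRight = (A k).toRight \ (A j).toRight := by ext; simp [hD]
    have h3 : (A j).toRight ⊆ (A k).toRight := fun x hx => by
      simp only [Finset.mem_toRight] at hx ⊢; exact hsub hx
    rw [h2, Finset.card_sdiff_of_subset h3]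
    exact (Nat.modEq_iff_dvd' (Finset.card_le_card h3)).1 h1
  have hDc : D.toLeft.card + D.toRight.card = k - j := by
    rw [Finset.card_toLeft_add_card_toRight, hDcard]
  have hsplit : ∀ i, ∑ s ∈ D, u s i = (∑ l ∈ D.toLeft, g l i : ℤ) + ∑ l ∈ D.toRight, h l i := by
    intro i
    conv_lhs => rw [← Finset.toLeft_disjSum_toRight (u := D)]
    rw [Finset.sum_disjSum]
    simp [u]
  rcases Nat.eq_zero_or_pos D.toRight.card with h0 | h0
  · refine ⟨D.toLeft, Finset.card_pos.1 (by omega), fun i => ?_⟩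
    have h1 := hDlt i
    rw [hsplit, Finset.card_eq_zero.1 h0, Finset.sum_empty, add_zero] at h1
    exact Int.abs_lt_one_iff.1 (by exact_mod_cast h1)
  · have hfull : D.toRight = Finset.univ := by
      rw [← Finset.card_eq_iff_eq_univ, Fintype.card_fin]
      exact le_antisymm (by simpa using Finset.card_le_univ D.toRight) (Nat.le_of_dvd h0 hright)
    have hfc : D.toRight.card = m := by rw [hfull]; simp
    refine ⟨D.toLeftᶜ, Finset.card_pos.1 (by rw [Finset.card_compl]; omega), fun i => ?_⟩
    have h1 := hDlt i
    have h2 := hsum i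
    have h3 : ∑ l ∈ D.toLeft, g l i + ∑ l ∈ D.toLeftᶜ, g l i = ∑ l, g l i :=
      Finset.sum_add_sum_compl _ _
    rw [hsplit, hfull] at h1
    have h4 : ((∑ l ∈ D.toLeft, g l i : ℤ) : ℝ) + ∑ l, h l i
        = ((-∑ l ∈ D.toLeftᶜ, g l i : ℤ) : ℝ) := by
      have h5 : ((∑ l ∈ D.toLeft, g l i : ℤ) : ℝ) + ((∑ l ∈ D.toLeftᶜ, g l i : ℤ) : ℝ)
          = ∑ l, (g l i : ℝ) := by exact_mod_cast h3
      push_cast at h5 ⊢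
      linarith
    rw [h4] at h1
    exact neg_eq_zero.1 (Int.abs_lt_one_iff.1 (by exact_mod_cast h1))

lemma exists_multiplicity_zero_sum {L : Type*} [Fintype L] {m : ℕ} (hm : 0 < m) {Δ : ℤ}
    (hΔ : 0 ≤ Δ) (μ : L → ℕ) (g : L → Fin m → ℤ) (hg : ∀ l i, |g l i| ≤ Δ)
    (h : Fin m → Fin m → ℝ) (hh : ∀ l i, |h l i| ≤ Δ)
    (hsum : ∀ i, ∑ l, (μ l : ℝ) * g l i + ∑ l, h l i = 0)
    (hcard : (m : ℤ) * (2 * m * Δ + 1) ^ m < ∑ l, (μ l : ℤ) + m) :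
    ∃ p : L → ℕ, p ≤ μ ∧ p ≠ 0 ∧ ∀ i, ∑ l, (p l : ℤ) * g l i = 0 := by
  classical
  obtain ⟨C, ⟨c, hc⟩, hC⟩ := exists_nonempty_zero_sum (ι := Σ l, Fin (μ l)) hm hΔ
    (fun s => g s.1) (fun s => hg s.1) h hh
    (fun i => by rw [← hsum i, Fintype.sum_sigma]; simp) (by simpa using hcard)
  refine ⟨fun l => (C.filter fun s => s.1 = l).card, fun l => ?_, fun h0 => ?_, fun i => ?_⟩
  · have hsub : (C.filter fun s => s.1 = l) ⊆
        (Finset.univ : Finset (Fin (μ l))).image (Sigma.mk l) := by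
      rintro ⟨l', t⟩ hs
      obtain rfl : l' = l := (Finset.mem_filter.1 hs).2
      exact Finset.mem_image_of_mem _ (Finset.mem_univ t)
    exact (Finset.card_le_card hsub).trans (Finset.card_image_le.trans (by simp))
  · have := Finset.card_eq_zero.1 (congrFun h0 c.1)
    exact Finset.notMem_empty c (this ▸ Finset.mem_filter.2 ⟨hc, rfl⟩)
  · rw [← hC i, ← Finset.sum_fiberwise C (fun s => s.1) (fun s => g s.1 i)]
    refine Finset.sum_congr rfl fun l _ => ?_
    rw [Finset.sum_congr rfl (g := fun _ => g l i)
      fun s hs => by rw [(Finset.mem_filter.1 hs).2]]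
    simp

lemma exists_exchange {m n : ℕ} (hm : 0 < m) {Δ : ℤ} {W : Matrix (Fin m) (Fin n) ℤ}
    (hΔ : ∀ i j, |W i j| ≤ Δ) {B : Fin m → Fin n}
    (hind : LinearIndependent ℝ (fun j : Fin m => fun i : Fin m => (W i (B j) : ℝ)))
    {b : Fin m → ℤ} {y : Fin m → ℝ} (hy : 0 ≤ y)
    (hyb : ∀ i, ∑ j, (W i (B j) : ℝ) * y j = b i) {x : Fin n → ℕ} {s : Fin m → ℕ}
    (hxs : ∀ i, ∑ j, W i j * x j + ∑ j, W i (B j) * s j = b i)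
    (hx : (m : ℤ) * (2 * m * Δ + 1) ^ m < ∑ j, (x j : ℤ)) :
    ∃ (x' : Fin n → ℕ) (s' : Fin m → ℕ),
      (∀ i, ∑ j, W i j * x' j + ∑ j, W i (B j) * s' j = b i) ∧ ∑ j, x' j < ∑ j, x j := by
  have hΔ0 : 0 ≤ Δ := (abs_nonneg _).trans (hΔ ⟨0, hm⟩ (B ⟨0, hm⟩))
  let z : Fin m → ℝ := fun j => y j - s j
  let σ : Fin m → ℤ := fun j => if 0 ≤ z j then 1 else -1
  have hσ : ∀ j, |σ j| = 1 := fun j => by simp only [σ]; split_ifs <;> simp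
  have hσz : ∀ j, (σ j : ℝ) * |z j| = z j := fun j => by
    simp only [σ]
    split_ifs with h
    · simp [abs_of_nonneg h]
    · simp [abs_of_neg (not_le.1 h)]
  let q₀ : Fin m → ℕ := fun j => ⌊|z j|⌋₊
  have hq₀ : ∀ j, (q₀ j : ℝ) ≤ |z j| := fun j => Nat.floor_le (abs_nonneg _)
  have hq₁ : ∀ j, |z j| < q₀ j + 1 := fun j => Nat.lt_floor_add_one _
  obtain ⟨p, hpμ, hp0, hp⟩ := exists_multiplicity_zero_sum hm hΔ0 (Sum.elim x q₀)
    (Sum.elim (fun j i => W i j) (fun j i => -(σ j * W i (B j))))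
    (by
      rintro (j | j) i
      · exact hΔ i j
      · simpa [abs_mul, hσ] using hΔ i (B j))
    (fun j i => -(σ j * (|z j| - q₀ j) * W i (B j)))
    (fun j i => by
      have h1 : |(σ j : ℝ)| = 1 := by exact_mod_cast hσ j
      have h2 : |(W i (B j) : ℝ)| ≤ Δ := by exact_mod_cast hΔ i (B j)
      have h3 : |(|z j|) - (q₀ j : ℝ)| ≤ 1 :=
        abs_le.2 ⟨by linarith [hq₀ j], by linarith [hq₁ j]⟩
      rw [abs_neg, abs_mul, abs_mul, h1, one_mul]
      exact (mul_le_of_le_one_left (abs_nonneg _) h3).trans h2)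
    (fun i => by
      have h1 : ∑ j, (W i j : ℝ) * x j + ∑ j, (W i (B j) : ℝ) * s j = b i := by
        exact_mod_cast hxs i
      have h2 : ∑ j, (q₀ j : ℝ) * (-(σ j * W i (B j)))
          + ∑ j, -(σ j * (|z j| - q₀ j) * W i (B j))
          = ∑ j, (W i (B j) : ℝ) * s j - ∑ j, (W i (B j) : ℝ) * y j := by
        rw [← Finset.sum_add_distrib, ← Finset.sum_sub_distrib]
        refine Finset.sum_congr rfl fun j _ => ?_
        linear_combination (-(W i (B j) : ℝ)) * hσz j
      have h3 : ∑ j, (x j : ℝ) * W i j = ∑ j, (W i j : ℝ) * x j :=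
        Finset.sum_congr rfl fun j _ => mul_comm _ _
      rw [Fintype.sum_sum_type]
      simp only [Sum.elim_inl, Sum.elim_inr]
      push_cast
      rw [h3, add_assoc, h2, hyb i]
      linarith)
    (by
      rw [Fintype.sum_sum_type]
      simp only [Sum.elim_inl, Sum.elim_inr]
      have : 0 ≤ ∑ j, (q₀ j : ℤ) := Finset.sum_nonneg fun _ _ => Int.natCast_nonneg _
      linarith [Int.natCast_nonneg m])
  have hpx : ∀ j, p (Sum.inl j) ≤ x j := fun j => hpμ (Sum.inl j)
  have hpq : ∀ j, p (Sum.inr j) ≤ q₀ j := fun j => hpμ (Sum.inr j)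
  have hrel : ∀ i, ∑ j, W i j * p (Sum.inl j)
      = ∑ j, W i (B j) * (σ j * p (Sum.inr j)) := by
    intro i
    have h1 := hp i
    rw [Fintype.sum_sum_type] at h1
    simp only [Sum.elim_inl, Sum.elim_inr, mul_neg, Finset.sum_neg_distrib] at h1
    rw [← sub_eq_add_neg, sub_eq_zero] at h1
    convert h1 using 2 <;> ring
  have hs' : ∀ j, 0 ≤ (s j : ℤ) + σ j * p (Sum.inr j) := by
    intro j
    simp only [σ]
    split_ifs with h
    · positivity
    · have h1 : (p (Sum.inr j) : ℝ) ≤ q₀ j := by exact_mod_cast hpq j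
      have h2 : |z j| ≤ s j := by
        rw [abs_of_neg (not_le.1 h)]
        simp only [z]
        linarith [show 0 ≤ y j from hy j]
      have h3 : (p (Sum.inr j) : ℝ) ≤ s j := h1.trans ((hq₀ j).trans h2)
      have h4 : p (Sum.inr j) ≤ s j := by exact_mod_cast h3
      omega
  refine ⟨fun j => x j - p (Sum.inl j), fun j => ((s j : ℤ) + σ j * p (Sum.inr j)).toNat,
    fun i => ?_, ?_⟩
  · rw [← hxs i]
    have h1 : ∀ j, ((x j - p (Sum.inl j) : ℕ) : ℤ) = x j - p (Sum.inl j) :=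
      fun j => Nat.cast_sub (hpx j)
    simp only [h1, Int.toNat_of_nonneg (hs' _), mul_sub, mul_add, Finset.sum_sub_distrib,
      Finset.sum_add_distrib, hrel i]
    ring
  · refine Finset.sum_lt_sum (fun j _ => Nat.sub_le _ _) ?_
    by_contra! hno
    have hl : ∀ j, p (Sum.inl j) = 0 := fun j => by
      have := hno j (Finset.mem_univ j)
      have := hpx j
      omega
    apply hp0
    have hr := Fintype.linearIndependent_iff.1 hind
      (fun j => ((σ j * p (Sum.inr j) : ℤ) : ℝ)) (by
        ext i
        have h1 := hrel i
        simp only [hl, Nat.cast_zero, mul_zero, Finset.sum_const_zero] at h1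
        have h2 : ∑ j, (W i (B j) : ℝ) * ((σ j * p (Sum.inr j) : ℤ) : ℝ) = 0 := by
          exact_mod_cast h1.symm
        rw [Finset.sum_apply, Pi.zero_apply, ← h2]
        exact Finset.sum_congr rfl fun j _ => mul_comm _ _)
    ext (j | j)
    · exact hl j
    · have h1 : σ j * (p (Sum.inr j) : ℤ) = 0 := by exact_mod_cast hr j
      rcases mul_eq_zero.1 h1 with h2 | h2
      · have := hσ j
        simp [h2] at this
      · exact_mod_cast h2

/-- Lemma 2: let `W ∈ ℤ^{m×n}` of rank `m` with entries bounded by `Δ`, and let `W_B`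
be a basis (m linearly independent columns). For `b ∈ cone(W_B) ∩ ℤ^m` one has
`b ∈ intcone(W)` iff there is `v ∈ intcone(W)` with `‖v‖∞ ≤ Δ·m·(2mΔ+1)^m` and
`b − v ∈ intcone(W_B)`. -/
theorem lemma_basis_decomposition (m n : ℕ) (Δ : ℤ)
    (W : Matrix (Fin m) (Fin n) ℤ) (hΔ : ∀ i j, |W i j| ≤ Δ)
    (hrank : (W.map (Int.cast : ℤ → ℚ)).rank = m)
    (B : Fin m → Fin n) (hB : Function.Injective B)
    (hind : LinearIndependent ℝ (fun j : Fin m => fun i : Fin m => (W i (B j) : ℝ)))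
    (b : Fin m → ℤ)
    -- `b ∈ cone(W_B)`
    (hb : ∃ x : Fin m → ℝ, 0 ≤ x ∧
      ((W.submatrix id B).map (Int.cast : ℤ → ℝ)).mulVec x = fun i => (b i : ℝ)) :
    -- `b ∈ intcone(W)` ↔ ∃ v ∈ intcone(W), ‖v‖∞ small, b − v ∈ intcone(W_B)
    (∃ x : Fin n → ℤ, 0 ≤ x ∧ W.mulVec x = b) ↔
      ∃ v : Fin m → ℤ,
        (∃ x : Fin n → ℤ, 0 ≤ x ∧ W.mulVec x = v) ∧
        (∀ i, |v i| ≤ Δ * (m : ℤ) * (2 * (m : ℤ) * Δ + 1) ^ m) ∧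
        (∃ y : Fin m → ℤ, 0 ≤ y ∧ (W.submatrix id B).mulVec y = b - v) := by
  constructor
  · rintro ⟨x, hx, hWx⟩
    rcases Nat.eq_zero_or_pos m with rfl | hm
    · exact ⟨b, ⟨x, hx, hWx⟩, fun i => i.elim0, 0, le_rfl, by simp⟩
    obtain ⟨y, hy, hyb⟩ := hb
    have hyb' : ∀ i, ∑ j, (W i (B j) : ℝ) * y j = b i := fun i => by
      simpa [Matrix.mulVec, dotProduct] using congrFun hyb i
    have hex : ∃ N : ℕ, ∃ (x : Fin n → ℕ) (s : Fin m → ℕ),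
        (∀ i, ∑ j, W i j * x j + ∑ j, W i (B j) * s j = b i) ∧ ∑ j, x j = N := by
      refine ⟨_, fun j => (x j).toNat, 0, fun i => ?_, rfl⟩
      simp only [Int.toNat_of_nonneg (hx _)]
      simpa [Matrix.mulVec, dotProduct] using congrFun hWx i
    classical
    obtain ⟨x', s, hxs, hN⟩ := Nat.find_spec hex
    have hsmall : ∑ j, (x' j : ℤ) ≤ (m : ℤ) * (2 * m * Δ + 1) ^ m := by
      by_contra! hlarge
      obtain ⟨x'', s'', h1, h2⟩ := exists_exchange hm hΔ hind hy hyb' hxs hlarge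
      exact Nat.find_min hex (hN ▸ h2) ⟨x'', s'', h1, rfl⟩
    have hΔ0 : 0 ≤ Δ := (abs_nonneg _).trans (hΔ ⟨0, hm⟩ (B ⟨0, hm⟩))
    refine ⟨W.mulVec fun j => (x' j : ℤ), ⟨_, fun j => Int.natCast_nonneg _, rfl⟩, fun i => ?_,
      fun j => s j, fun j => Int.natCast_nonneg _, ?_⟩
    · calc |∑ j, W i j * x' j| ≤ ∑ j, |W i j * x' j| :=
            Finset.abs_sum_le_sum_abs _ _
        _ ≤ ∑ j, Δ * x' j := by
            refine Finset.sum_le_sum fun j _ => ?_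
            rw [abs_mul, Nat.abs_cast]
            exact mul_le_mul_of_nonneg_right (hΔ i j) (Int.natCast_nonneg _)
        _ = Δ * ∑ j, (x' j : ℤ) := (Finset.mul_sum _ _ _).symm
        _ ≤ Δ * (m * (2 * m * Δ + 1) ^ m) := mul_le_mul_of_nonneg_left hsmall hΔ0
        _ = Δ * m * (2 * m * Δ + 1) ^ m := (mul_assoc _ _ _).symm
    · ext i
      simp only [Matrix.mulVec, dotProduct, Matrix.submatrix_apply, id_eq, Pi.sub_apply]
      linarith [hxs i]
  · rintro ⟨v, ⟨x, hx, hWx⟩, -, y, hy, hWy⟩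
    classical
    refine ⟨x + ∑ j, Pi.single (B j) (y j),
      add_nonneg hx (Finset.sum_nonneg fun j _ => Pi.single_nonneg.2 (hy j)), ?_⟩
    rw [Matrix.mulVec_add, hWx, Matrix.mulVec_sum, ← eq_sub_iff_add_eq', ← hWy]
    ext i
    simp [Matrix.mulVec, dotProduct, Finset.sum_apply, mul_comm]
end

section
/- Let W be an m×n integer matrix of rank m with all entries of absolute value at most Δ, and let 𝒞 = {v ∈ intcone(W) : ‖v‖_∞ ≤ Δ·m·(2mΔ + 1)^m}. Then for every b ∈ cone(W) ∩ ℤ^m, one has b ∈ intcone(W) if and only if there exist a set B ⊆ {1,…,n} of m indices such that the columns of W indexed by B are linearly independent and b ∈ cone(W_B), and an element c ∈ 𝒞 such that b − c ∈ intcone(W_B). -/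
open Matrix

/-- Ratio test: moving positive slacks `p` in a direction `q` that decreases one of them, one can
stop exactly when the first slack vanishes. -/
theorem exists_ratio_test {κ : Type*} (s : Finset κ) (p q : κ → ℝ) (hp : ∀ k ∈ s, 0 < p k)
    (hq : ∃ k ∈ s, q k < 0) :
    ∃ t : ℝ, (∀ k ∈ s, 0 ≤ p k + t * q k) ∧ ∃ k ∈ s, p k + t * q k = 0 := by
  obtain ⟨k₀, hk₀, hqk₀⟩ := hq
  obtain ⟨k, hk, hmin⟩ := Finset.exists_min_image (s.filter (fun k => q k < 0))
    (fun k => p k / (-q k)) ⟨k₀, Finset.mem_filter.2 ⟨hk₀, hqk₀⟩⟩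
  rw [Finset.mem_filter] at hk
  refine ⟨p k / (-q k), fun l hl => ?_, k, hk.1, ?_⟩
  · have ht : 0 ≤ p k / (-q k) := div_nonneg (hp k hk.1).le (by linarith [hk.2])
    rcases lt_or_ge (q l) 0 with h | h
    · have h1 := hmin l (Finset.mem_filter.2 ⟨hl, h⟩)
      have h2 := mul_le_mul_of_nonneg_right h1 (by linarith : 0 ≤ -q l)
      rw [div_mul_cancel₀ (p l) (by linarith : -q l ≠ 0)] at h2
      linarith
    · have := hp l hl
      positivity
  · have : q k ≠ 0 := hk.2.ne
    field_simp
    ring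

/-- A nontrivial linear relation supported on a finset on which the family is dependent. -/
theorem exists_relation_of_not_linearIndepOn {ι E : Type*} [Fintype ι] [DecidableEq ι]
    [AddCommGroup E] [Module ℝ E] (v : ι → E) (F : Finset ι)
    (h : ¬ LinearIndepOn ℝ v (F : Set ι)) :
    ∃ g : ι → ℝ, (∀ i ∉ F, g i = 0) ∧ ∑ i, g i • v i = 0 ∧ ∃ i ∈ F, g i < 0 := by
  rw [linearIndepOn_finset_iff] at h
  push Not at h
  obtain ⟨g, hg, i, hi, hgi⟩ := h
  have key : ∀ c : ℝ, c * g i < 0 → ∃ g : ι → ℝ, (∀ i ∉ F, g i = 0) ∧ ∑ i, g i • v i = 0 ∧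
      ∃ i ∈ F, g i < 0 := by
    intro c hc
    refine ⟨fun j => if j ∈ F then c * g j else 0, fun j hj => if_neg hj, ?_, i, hi, ?_⟩
    · simp only [ite_smul, zero_smul, Finset.sum_ite_mem, Finset.univ_inter, mul_smul,
        ← Finset.smul_sum, hg, smul_zero]
    · simpa [hi] using hc
  rcases lt_or_gt_of_ne hgi with h | h
  · exact key 1 (by simpa using h)
  · exact key (-1) (by simpa using h)

/-- A point of the unit cube can be moved, without changing the linear combination it defines, so
that at most `finrank ℝ E` of its coordinates are fractional. -/
theorem exists_few_fractional {ι E : Type*} [Fintype ι] [DecidableEq ι]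
    [AddCommGroup E] [Module ℝ E] [Module.Finite ℝ E] (v : ι → E) (μ : ι → ℝ)
    (h0 : ∀ i, 0 ≤ μ i) (h1 : ∀ i, μ i ≤ 1) :
    ∃ ν : ι → ℝ, (∀ i, 0 ≤ ν i) ∧ (∀ i, ν i ≤ 1) ∧ ∑ i, ν i • v i = ∑ i, μ i • v i ∧
      (∀ i, μ i = 0 → ν i = 0) ∧
      (Finset.univ.filter (fun i => 0 < ν i ∧ ν i < 1)).card ≤ Module.finrank ℝ E := by
  induction hN : (Finset.univ.filter (fun i => 0 < μ i ∧ μ i < 1)).card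
    using Nat.strong_induction_on generalizing μ with
  | _ N ih =>
  set F := Finset.univ.filter (fun i => 0 < μ i ∧ μ i < 1) with hF
  by_cases hc : F.card ≤ Module.finrank ℝ E
  · exact ⟨μ, h0, h1, rfl, fun _ h => h, hc⟩
  have hdep : ¬ LinearIndepOn ℝ v (F : Set ι) := by
    intro h
    have := LinearIndependent.fintype_card_le_finrank h
    simp at this
    omega
  obtain ⟨g, hgF, hg, i, hi, hgi⟩ := exists_relation_of_not_linearIndepOn v F hdep
  obtain ⟨t, ht, ⟨k, b⟩, hk, hkt⟩ := exists_ratio_test (F ×ˢ (Finset.univ : Finset Bool))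
    (fun x => if x.2 then μ x.1 else 1 - μ x.1) (fun x => if x.2 then g x.1 else - g x.1)
    (by
      rintro ⟨k, b⟩ hk
      have : 0 < μ k ∧ μ k < 1 := by simpa [hF] using hk
      cases b <;> simp <;> linarith)
    ⟨(i, true), by simp [hi], by simpa using hgi⟩
  have hkF : k ∈ F := by simpa using hk
  have hout : ∀ j ∉ F, μ j + t * g j = μ j := fun j hj => by simp [hgF j hj]
  have hsub : Finset.univ.filter (fun i => 0 < μ i + t * g i ∧ μ i + t * g i < 1) ⊂ F := by
    refine Finset.ssubset_iff_of_subset ?_ |>.2 ⟨k, hkF, ?_⟩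
    · intro j hj
      by_contra hjF
      rw [Finset.mem_filter, hout j hjF] at hj
      exact hjF (Finset.mem_filter.2 hj)
    · cases b <;> simp at hkt ⊢ <;> intros <;> linarith
  have hbox : ∀ j, 0 ≤ μ j + t * g j ∧ μ j + t * g j ≤ 1 := by
    intro j
    by_cases hj : j ∈ F
    · have hlo := ht (j, true) (by simp [hj])
      have hhi := ht (j, false) (by simp [hj])
      simp at hlo hhi
      constructor <;> linarith
    · rw [hout j hj]
      exact ⟨h0 j, h1 j⟩
  obtain ⟨ν, hν0, hν1, hν, hνz, hνc⟩ := ih _ (hN ▸ Finset.card_lt_card hsub)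
    (fun j => μ j + t * g j) (fun j => (hbox j).1) (fun j => (hbox j).2) rfl
  refine ⟨ν, hν0, hν1, ?_, fun j hj => hνz j ?_, hνc⟩
  · rw [hν]
    simp only [add_smul, Finset.sum_add_distrib, mul_smul, ← Finset.smul_sum, hg, smul_zero,
      add_zero]
  · rw [hout j, hj]
    simp [hF, hj]

/-- The set `A` carries Steinitz weights for the family `v`: weights in `[0, 1]` of total mass
`#A - finrank ℝ E` under which the family sums to the proportional part of its total. -/
def HasSteinitzWeights {ι E : Type*} [Fintype ι] [AddCommGroup E] [Module ℝ E] (v : ι → E)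
    (A : Finset ι) : Prop :=
  ∃ μ : ι → ℝ, (∀ i, 0 ≤ μ i) ∧ (∀ i, μ i ≤ 1) ∧ (∀ i ∉ A, μ i = 0) ∧
    ∑ i, μ i = A.card - Module.finrank ℝ E ∧
    ∑ i, μ i • v i =
      (((A.card : ℝ) - Module.finrank ℝ E) / Fintype.card ι) • ∑ i, v i

theorem hasSteinitzWeights_univ {ι E : Type*} [Fintype ι] [AddCommGroup E] [Module ℝ E]
    (v : ι → E) (h : Module.finrank ℝ E ≤ Fintype.card ι) (hι : 0 < Fintype.card ι) :
    HasSteinitzWeights v Finset.univ := by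
  have h' : (Module.finrank ℝ E : ℝ) ≤ Fintype.card ι := by exact_mod_cast h
  have hι' : (0 : ℝ) < Fintype.card ι := by exact_mod_cast hι
  refine ⟨fun _ => ((Fintype.card ι : ℝ) - Module.finrank ℝ E) / Fintype.card ι,
    fun _ => div_nonneg (by linarith) hι'.le, fun _ => ?_, by simp, ?_, ?_⟩
  · rw [div_le_one hι']
    have : (0 : ℝ) ≤ Module.finrank ℝ E := Nat.cast_nonneg _
    linarith
  · simp only [Finset.sum_const, Finset.card_univ, nsmul_eq_mul]
    field_simp
  · simp [Finset.smul_sum]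

theorem HasSteinitzWeights.exists_erase {ι E : Type*} [Fintype ι] [DecidableEq ι]
    [AddCommGroup E] [Module ℝ E] [Module.Finite ℝ E] {v : ι → E} {A : Finset ι}
    (hA : HasSteinitzWeights v A) (hcard : Module.finrank ℝ E < A.card) :
    ∃ i ∈ A, HasSteinitzWeights v (A.erase i) := by
  obtain ⟨μ, h0, h1, hout, hsum, hv⟩ := hA
  set d := Module.finrank ℝ E with hd
  have hcard' : (d : ℝ) + 1 ≤ A.card := by exact_mod_cast hcard
  set r : ℝ := (A.card - 1 - d) / (A.card - d) with hr
  have hr0 : 0 ≤ r := div_nonneg (by linarith) (by linarith)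
  have hr1 : r ≤ 1 := by rw [hr, div_le_one] <;> linarith
  have hrmul : r * (A.card - d) = A.card - 1 - d := div_mul_cancel₀ _ (by linarith)
  obtain ⟨ν, hν0, hν1, hν, hνz, hνc⟩ := exists_few_fractional (fun i => (v i, (1 : ℝ)))
    (fun i => r * μ i) (fun i => mul_nonneg hr0 (h0 i))
    (fun i => mul_le_one₀ hr1 (h0 i) (h1 i))
  have hνsum : ∑ i, ν i = A.card - 1 - d := by
    have := congrArg Prod.snd hν
    simp only [Prod.snd_sum, Prod.smul_snd, smul_eq_mul, mul_one, ← Finset.mul_sum, hsum] at this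
    rw [this, hrmul]
  have hνv : ∑ i, ν i • v i = (((A.card : ℝ) - 1 - d) / Fintype.card ι) • ∑ i, v i := by
    have := congrArg Prod.fst hν
    simp only [Prod.fst_sum, Prod.smul_fst, mul_smul, ← Finset.smul_sum, hv] at this
    rw [this, smul_smul, ← mul_div_assoc, hrmul]
  have hνout : ∀ i ∉ A, ν i = 0 := fun i hi => hνz i (by simp [hout i hi])
  obtain ⟨i, hi, hνi⟩ : ∃ i ∈ A, ν i = 0 := by
    by_contra! hne
    set F := Finset.univ.filter (fun i => 0 < ν i ∧ ν i < 1) with hF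
    have hFA : F ⊆ A := fun i hi => by
      by_contra h
      have := hνout i h
      simp [hF, this] at hi
    have hsplit : ∑ i, ν i = ((A \ F).card : ℝ) + ∑ i ∈ F, ν i := by
      rw [← Finset.sum_subset (Finset.subset_univ A) (fun i _ hi => hνout i hi),
        ← Finset.sum_sdiff hFA]
      congr 1
      rw [Finset.sum_congr rfl (g := fun _ => (1 : ℝ))]
      · simp
      · intro i hi
        rw [Finset.mem_sdiff] at hi
        have hpos := (hν0 i).lt_of_ne' (hne i hi.1)
        by_contra h
        exact hi.2 (by simp [hF, hpos, (hν1 i).lt_of_ne h])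
    have hcF : ((A \ F).card : ℝ) = A.card - F.card := by
      rw [Finset.card_sdiff_of_subset hFA, Nat.cast_sub (Finset.card_le_card hFA)]
    have hFd : (F.card : ℝ) ≤ d + 1 := by
      have : F.card ≤ d + 1 := by simpa [← hd] using hνc
      exact_mod_cast this
    rcases F.eq_empty_or_nonempty with he | hne'
    · simp [he] at hsplit
      have : (0 : ℝ) ≤ d := Nat.cast_nonneg _
      linarith
    · have : 0 < ∑ i ∈ F, ν i := Finset.sum_pos (fun i hi => (Finset.mem_filter.1 hi).2.1) hne'
      linarith
  have hce : ((A.erase i).card : ℝ) = A.card - 1 := by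
    rw [Finset.card_erase_of_mem hi, Nat.cast_pred (Finset.card_pos.2 ⟨i, hi⟩)]
  refine ⟨i, hi, ν, hν0, hν1, fun j hj => ?_, ?_, ?_⟩
  · by_cases h : j = i
    · rw [h, hνi]
    · exact hνout j (fun hjA => hj (Finset.mem_erase.2 ⟨h, hjA⟩))
  · rw [hce, hνsum]
  · rw [hce, hνv]

/-- Steinitz's lemma, as a descending chain of sets carrying Steinitz weights. -/
theorem exists_steinitz_chain_s10 {ι E : Type*} [Fintype ι] [DecidableEq ι]
    [AddCommGroup E] [Module ℝ E] [Module.Finite ℝ E] (v : ι → E)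
    (h : Module.finrank ℝ E ≤ Fintype.card ι) (hι : 0 < Fintype.card ι) :
    ∃ C : ℕ → Finset ι, Antitone C ∧ ∀ j, j ≤ Fintype.card ι - Module.finrank ℝ E →
      (C j).card = Fintype.card ι - j ∧ HasSteinitzWeights v (C j) := by
  have hstep : ∀ A : Finset ι, ∃ A' ⊆ A, HasSteinitzWeights v A → Module.finrank ℝ E < A.card →
      A'.card = A.card - 1 ∧ HasSteinitzWeights v A' := by
    intro A
    by_cases hA : HasSteinitzWeights v A ∧ Module.finrank ℝ E < A.card
    · obtain ⟨i, hi, hw⟩ := hA.1.exists_erase hA.2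
      exact ⟨A.erase i, Finset.erase_subset _ _, fun _ _ => ⟨Finset.card_erase_of_mem hi, hw⟩⟩
    · exact ⟨A, subset_rfl, fun h1 h2 => absurd ⟨h1, h2⟩ hA⟩
  choose next hsub hnext using hstep
  refine ⟨fun j => next^[j] Finset.univ, antitone_nat_of_succ_le fun j => ?_, fun j => ?_⟩
  · simp only [Function.iterate_succ_apply']
    exact hsub _
  · induction j with
    | zero => exact fun _ => ⟨by simp, hasSteinitzWeights_univ v h hι⟩
    | succ j ih =>
      intro hj
      obtain ⟨hc, hw⟩ := ih (by omega)
      beta_reduce at hc hw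
      simp only [Function.iterate_succ_apply']
      obtain ⟨hc', hw'⟩ := hnext _ hw (by omega)
      exact ⟨by omega, hw'⟩

theorem HasSteinitzWeights.abs_sum_sub_le {ι : Type*} [Fintype ι] {m : ℕ}
    {v : ι → Fin m → ℝ} {A : Finset ι} (hA : HasSteinitzWeights v A) {Δ : ℝ}
    (hv : ∀ i r, |v i r| ≤ Δ) (r : Fin m) :
    |∑ i ∈ A, v i r - ((A.card : ℝ) - m) / Fintype.card ι * ∑ i, v i r| ≤ m * Δ := by
  obtain ⟨μ, h0, h1, hout, hsum, hμ⟩ := hA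
  rw [Module.finrank_fin_fun] at hsum hμ
  have hμr := congrFun hμ r
  simp only [Finset.sum_apply, Pi.smul_apply, smul_eq_mul] at hμr
  rw [← Finset.sum_subset (Finset.subset_univ A) (fun i _ hi => hout i hi)] at hsum
  rw [← hμr, ← Finset.sum_subset (Finset.subset_univ A) (fun i _ hi => by simp [hout i hi]),
    ← Finset.sum_sub_distrib]
  calc |∑ i ∈ A, (v i r - μ i * v i r)| ≤ ∑ i ∈ A, |v i r - μ i * v i r| :=
        Finset.abs_sum_le_sum_abs _ _
    _ ≤ ∑ i ∈ A, (1 - μ i) * Δ := by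
        refine Finset.sum_le_sum fun i _ => ?_
        rw [show v i r - μ i * v i r = (1 - μ i) * v i r by ring, abs_mul,
          abs_of_nonneg (by linarith [h1 i])]
        exact mul_le_mul_of_nonneg_left (hv i r) (by linarith [h1 i])
    _ = m * Δ := by
        rw [← Finset.sum_mul, Finset.sum_sub_distrib, hsum]
        simp

theorem one_add_inv_four_mul_pow_le (m : ℕ) (hm : 0 < m) :
    3 * (1 + 1 / (4 * (m : ℝ))) ^ m ≤ 4 := by
  have hm' : (1 : ℝ) ≤ m := by exact_mod_cast hm
  set a : ℝ := 1 / (4 * (m : ℝ)) with ha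
  have hma : m * a = 1 / 4 := by rw [ha]; field_simp
  have ha0 : 0 < a := by positivity
  have ha1 : a ≤ 1 / 4 := by nlinarith
  have h1 : 1 + (m : ℝ) * (-a) ≤ (1 + (-a)) ^ m := one_add_mul_le_pow (by linarith) m
  have h2 : (1 + a) ^ m * (1 + (-a)) ^ m ≤ 1 := by
    rw [← mul_pow]
    exact pow_le_one₀ (by nlinarith) (by nlinarith)
  have h3 : (0 : ℝ) < (1 + a) ^ m := by positivity
  nlinarith

/-- Distinct integer points near the segment from `0` to `f`, a vector of norm at most `m * Δ / 2`,
are few in number. -/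
theorem card_le_of_near_segment {m : ℕ} (hm : 0 < m) {Δ : ℝ} (hΔ : 0 ≤ Δ) (S : Finset ℕ)
    (s : ℕ → Fin m → ℤ) (hs : Set.InjOn s S) (t : ℕ → ℝ) (ht0 : ∀ j ∈ S, 0 ≤ t j)
    (ht1 : ∀ j ∈ S, t j < 1) (f : Fin m → ℝ) (hf : ∀ r, |f r| ≤ m * Δ / 2)
    (hst : ∀ j ∈ S, ∀ r, |(s j r : ℝ) - t j * f r| ≤ m * Δ) :
    3 * (S.card : ℝ) ≤ 4 * (m * (2 * m * Δ + 1) ^ m) := by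
  have hm' : (0 : ℝ) < m := by exact_mod_cast hm
  set R : ℝ := m * Δ + Δ / 4 with hR
  have hR0 : 0 ≤ R := by positivity
  have hmaps : ∀ j ∈ S, ⌊t j * m⌋₊ ∈ Finset.range m := fun j hj => by
    rw [Finset.mem_range, Nat.floor_lt (mul_nonneg (ht0 j hj) hm'.le)]
    nlinarith [ht1 j hj]
  have hfib : ∀ i ∈ Finset.range m,
      ((S.filter (fun j => ⌊t j * m⌋₊ = i)).card : ℝ) ≤ (2 * R + 1) ^ m := by
    intro i _
    set c : Fin m → ℝ := fun r => (i + 1 / 2) / m * f r with hc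
    have hsub : ∀ j ∈ S.filter (fun j => ⌊t j * m⌋₊ = i),
        s j ∈ Fintype.piFinset (fun r => Finset.Icc ⌈c r - R⌉ ⌊c r + R⌋) := by
      intro j hj
      obtain ⟨hjS, hji⟩ := Finset.mem_filter.1 hj
      rw [Nat.floor_eq_iff (mul_nonneg (ht0 j hjS) hm'.le)] at hji
      rw [Fintype.mem_piFinset]
      intro r
      have hdist : |t j * f r - c r| ≤ Δ / 4 := by
        have h1 : |t j - (i + 1 / 2) / m| ≤ 1 / 2 / m := by
          have : t j - (i + 1 / 2) / m = (t j * m - (i + 1 / 2)) / m := by field_simp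
          rw [this, abs_div, abs_of_pos hm']
          gcongr
          rw [abs_le]
          constructor <;> linarith
        calc |t j * f r - c r| = |t j - (i + 1 / 2) / m| * |f r| := by
              rw [← abs_mul, hc]; ring_nf
          _ ≤ (1 / 2 / m) * (m * Δ / 2) := by gcongr; exact hf r
          _ = Δ / 4 := by field_simp; ring
      have h2 := abs_le.1 (hst j hjS r)
      have h3 := abs_le.1 hdist
      rw [Finset.mem_Icc, Int.ceil_le, Int.le_floor]
      constructor <;> linarith
    have hcard := Finset.card_le_card_of_injOn s hsub
      (hs.mono (by simp only [Finset.coe_filter]; exact fun _ h => h.1))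
    rw [Fintype.card_piFinset] at hcard
    calc ((S.filter (fun j => ⌊t j * m⌋₊ = i)).card : ℝ)
        ≤ ∏ r : Fin m, ((Finset.Icc ⌈c r - R⌉ ⌊c r + R⌋).card : ℝ) := by exact_mod_cast hcard
      _ ≤ ∏ _r : Fin m, (2 * R + 1) := by
          refine Finset.prod_le_prod (fun _ _ => Nat.cast_nonneg _) fun r _ => ?_
          rw [Int.card_Icc]
          have h1 := Int.floor_le (c r + R)
          have h2 := Int.le_ceil (c r - R)
          have h3 : ((⌊c r + R⌋ + 1 - ⌈c r - R⌉).toNat : ℝ) =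
              ((max (⌊c r + R⌋ + 1 - ⌈c r - R⌉) 0 : ℤ) : ℝ) := by
            exact_mod_cast Int.toNat_eq_max _
          rw [h3]
          push_cast
          refine max_le ?_ (by linarith)
          linarith
      _ = (2 * R + 1) ^ m := by simp
  have hS : (S.card : ℝ) ≤ m * (2 * R + 1) ^ m := by
    rw [Finset.card_eq_sum_card_fiberwise hmaps]
    push_cast
    exact (Finset.sum_le_sum hfib).trans (by simp)
  have hpow : (2 * R + 1) ^ m ≤ (2 * m * Δ + 1) ^ m * (1 + 1 / (4 * (m : ℝ))) ^ m := by
    rw [← mul_pow]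
    refine pow_le_pow_left₀ (by linarith) ?_ m
    have : (2 * m * Δ + 1) * (1 + 1 / (4 * (m : ℝ))) =
        2 * m * Δ + 1 + Δ / 2 + 1 / (4 * (m : ℝ)) := by field_simp; ring
    rw [this, hR]
    have : 0 ≤ 1 / (4 * (m : ℝ)) := by positivity
    linarith
  have hK : 0 ≤ m * (2 * m * Δ + 1) ^ m := by positivity
  have h4 := mul_le_mul_of_nonneg_left (one_add_inv_four_mul_pow_le m hm) hK
  have h5 := mul_le_mul_of_nonneg_left hpow hm'.le
  linarith

theorem mulVec_extend_zero {R α β γ : Type*} [Semiring R] [Fintype β] [Fintype γ]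
    (A : Matrix α β R) {B : γ → β} (hB : Function.Injective B) (y : γ → R) :
    A *ᵥ Function.extend B y 0 = A.submatrix id B *ᵥ y := by
  ext i
  simp only [mulVec, dotProduct, submatrix_apply, id]
  classical
  rw [← Finset.sum_subset (Finset.subset_univ (Finset.univ.image B)),
    Finset.sum_image (fun a _ b _ h => hB h)]
  · simp [hB.extend_apply]
  · intro j _ hj
    rw [Function.extend_apply' _ _ _ (by simpa using hj)]
    simp

/-- A nonnegative combination may be taken with linearly independent support. -/
theorem exists_nonneg_linearIndepOn_support {ι E : Type*} [Fintype ι] [DecidableEq ι]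
    [AddCommGroup E] [Module ℝ E] (v : ι → E) (x : ι → ℝ) (hx : 0 ≤ x) :
    ∃ y : ι → ℝ, 0 ≤ y ∧ ∑ i, y i • v i = ∑ i, x i • v i ∧
      LinearIndepOn ℝ v (Function.support y) := by
  induction hN : (Finset.univ.filter (fun i => 0 < x i)).card
    using Nat.strong_induction_on generalizing x with
  | _ N ih =>
  set F := Finset.univ.filter (fun i => 0 < x i) with hF
  have hsupp : (F : Set ι) = Function.support x := by
    ext i
    simpa [hF] using (hx i).lt_iff_ne'
  by_cases hc : LinearIndepOn ℝ v (F : Set ι)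
  · exact ⟨x, hx, rfl, hsupp ▸ hc⟩
  obtain ⟨g, hgF, hg, i, hi, hgi⟩ := exists_relation_of_not_linearIndepOn v F hc
  obtain ⟨t, ht, k, hk, hkt⟩ := exists_ratio_test F x g (fun i hi => by simpa [hF] using hi)
    ⟨i, hi, hgi⟩
  have hout : ∀ j ∉ F, x j + t * g j = x j := fun j hj => by simp [hgF j hj]
  have hsub : Finset.univ.filter (fun i => 0 < x i + t * g i) ⊂ F := by
    refine Finset.ssubset_iff_of_subset ?_ |>.2 ⟨k, hk, by simp [hkt]⟩
    intro j hj
    by_contra hjF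
    rw [Finset.mem_filter, hout j hjF] at hj
    exact hjF (Finset.mem_filter.2 hj)
  obtain ⟨y, hy0, hy, hyi⟩ := ih _ (hN ▸ Finset.card_lt_card hsub) (fun j => x j + t * g j)
    (fun j => by
      by_cases hj : j ∈ F
      · exact ht j hj
      · simpa [hout j hj] using hx j) rfl
  refine ⟨y, hy0, ?_, hyi⟩
  rw [hy]
  simp only [add_smul, Finset.sum_add_distrib, mul_smul, ← Finset.smul_sum, hg, smul_zero,
    add_zero]

theorem rank_map_intCast_real {m n : ℕ} (W : Matrix (Fin m) (Fin n) ℤ)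
    (h : (W.map (Int.cast : ℤ → ℚ)).rank = m) : (W.map (Int.cast : ℤ → ℝ)).rank = m := by
  have hli : LinearIndependent ℚ (W.map (Int.cast : ℤ → ℚ)).row := by
    rw [linearIndependent_iff_card_eq_finrank_span, Set.finrank, ← rank_eq_finrank_span_row, h,
      Fintype.card_fin]
  have hli' : LinearIndependent ℝ (W.map (Int.cast : ℤ → ℝ)).row := by
    have heq : (fun i => algebraMap ℚ ℝ ∘ (W.map (Int.cast : ℤ → ℚ)).row i) =
        (W.map (Int.cast : ℤ → ℝ)).row := by
      ext i j
      simp [Matrix.row]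
    exact heq ▸ linearIndependent_algebraMap_comp_iff (S := ℝ).2 hli
  simpa using hli'.rank_matrix

/-- Every point of the cone of a matrix of full row rank lies in the cone of a basis of columns. -/
theorem exists_basis_mem_cone {m : ℕ} {n : Type*} [Fintype n] [DecidableEq n]
    (A : Matrix (Fin m) n ℝ) (hA : A.rank = m) (x : n → ℝ) (hx : 0 ≤ x) :
    ∃ B : Fin m → n, Function.Injective B ∧ LinearIndependent ℝ (A.col ∘ B) ∧
      ∃ y : Fin m → ℝ, 0 ≤ y ∧ A.submatrix id B *ᵥ y = A *ᵥ x := by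
  obtain ⟨y, hy0, hy, hli⟩ := exists_nonneg_linearIndepOn_support A.col x hx
  obtain ⟨S, -, hyS, hspan, hS⟩ := exists_linearIndepOn_extension hli (Set.subset_univ _)
  have : Fintype S := Fintype.ofFinite S
  have hcard : Fintype.card S = m := by
    rw [rank_eq_finrank_span_cols] at hA
    rw [Set.image_univ, Set.image_eq_range] at hspan
    have hspan' : Submodule.span ℝ (Set.range fun j : S => A.col j) =
        Submodule.span ℝ (Set.range A.col) :=
      le_antisymm (Submodule.span_mono (Set.range_comp_subset_range _ _))
        (Submodule.span_le.2 hspan)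
    exact (linearIndependent_iff_card_eq_finrank_span.1 hS).trans
      ((congrArg (fun p : Submodule ℝ (Fin m → ℝ) => Module.finrank ℝ p) hspan').trans hA)
  let e : Fin m ≃ S := (Fintype.equivFinOfCardEq hcard).symm
  have hinj : Function.Injective (fun k => (e k : n)) := Subtype.val_injective.comp e.injective
  refine ⟨fun k => e k, hinj, hS.comp e e.injective, fun k => y (e k), fun k => hy0 _, ?_⟩
  rw [← mulVec_extend_zero A hinj]
  have hext : Function.extend (fun k => (e k : n)) (fun k => y (e k)) 0 = y := by
    ext j
    by_cases hj : j ∈ S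
    · have : (e (e.symm ⟨j, hj⟩) : n) = j := by simp
      rw [← this, hinj.extend_apply]
    · rw [Function.extend_apply']
      · by_contra h
        exact hj (hyS (fun h' => h (by simp [h'])))
      · rintro ⟨k, rfl⟩
        exact hj (e k).2
  rw [hext]
  ext i
  have := congrFun hy i
  simpa [mulVec, dotProduct, Finset.sum_apply, mul_comm] using this

/-- The multiset of signed columns described by an integer vector `d`, as a family indexed by
`∑ j, |d j|` elements. -/
def signedColumn {m n : ℕ} (W : Matrix (Fin m) (Fin n) ℤ) (d : Fin n → ℤ)
    (p : Σ j, Fin (d j).natAbs) (r : Fin m) : ℤ :=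
  (d p.1).sign * W r p.1

/-- The integer vector described by a set of signed columns. -/
def signedCount {n : ℕ} (d : Fin n → ℤ) (C : Finset (Σ j, Fin (d j).natAbs)) (j : Fin n) : ℤ :=
  (d j).sign * (C.filter (fun p => p.1 = j)).card

theorem sum_signedColumn {m n : ℕ} (W : Matrix (Fin m) (Fin n) ℤ) (d : Fin n → ℤ)
    (C : Finset (Σ j, Fin (d j).natAbs)) :
    (fun r => ∑ p ∈ C, signedColumn W d p r) = W *ᵥ signedCount d C := by
  ext r
  rw [← Finset.sum_fiberwise_of_maps_to (t := Finset.univ) (g := Sigma.fst) (by simp)]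
  simp only [mulVec, dotProduct, signedCount]
  refine Finset.sum_congr rfl fun j _ => ?_
  rw [Finset.sum_congr rfl (g := fun _ => (d j).sign * W r j)]
  · simp only [Finset.sum_const, nsmul_eq_mul]
    ring
  · intro p hp
    simp [signedColumn, (Finset.mem_filter.1 hp).2]

theorem card_filter_fst_le {n : ℕ} (d : Fin n → ℤ) (C : Finset (Σ j, Fin (d j).natAbs))
    (j : Fin n) : (C.filter (fun p => p.1 = j)).card ≤ (d j).natAbs := by
  have h : C.filter (fun p => p.1 = j) ⊆ Finset.univ.image (Sigma.mk j) := by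
    rintro ⟨k, i⟩ hp
    obtain rfl : k = j := (Finset.mem_filter.1 hp).2
    simp
  calc _ ≤ _ := Finset.card_le_card h
    _ ≤ _ := Finset.card_image_le
    _ = _ := by simp

theorem signedCount_univ {n : ℕ} (d : Fin n → ℤ) : signedCount d Finset.univ = d := by
  ext j
  have h : Finset.univ.filter (fun p : Σ j, Fin (d j).natAbs => p.1 = j) =
      Finset.univ.image (Sigma.mk j) := by
    ext ⟨k, i⟩
    simp only [Finset.mem_filter, Finset.mem_univ, true_and, Finset.mem_image]
    constructor
    · rintro rfl
      exact ⟨i, rfl⟩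
    · rintro ⟨i, hi⟩
      exact (congrArg Sigma.fst hi).symm
  rw [signedCount, h, Finset.card_image_of_injective _ sigma_mk_injective, Finset.card_univ,
    Fintype.card_fin, Int.sign_mul_natAbs]

/-- An integer solution of `W z = b`, `z ≥ 0` that is as close as possible to `y` has no
nonempty set of signed columns of `z - y` with sum zero. -/
theorem sum_signedColumn_ne_zero {m n : ℕ} (W : Matrix (Fin m) (Fin n) ℤ) (y z : Fin n → ℤ)
    (hy : 0 ≤ y) (hz : 0 ≤ z)
    (hmin : ∀ z' : Fin n → ℤ, 0 ≤ z' → W *ᵥ z' = W *ᵥ z →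
      ∑ j, (z j - y j).natAbs ≤ ∑ j, (z' j - y j).natAbs)
    (C : Finset (Σ j, Fin ((z - y) j).natAbs)) (hC : C.Nonempty) :
    (fun r => ∑ p ∈ C, signedColumn W (z - y) p r) ≠ 0 := by
  intro h0
  rw [sum_signedColumn] at h0
  have hle := card_filter_fst_le (z - y) C
  have hbd : ∀ j, 0 ≤ z j - signedCount (z - y) C j ∧
      (z j - signedCount (z - y) C j - y j).natAbs + (C.filter (fun p => p.1 = j)).card =
        (z j - y j).natAbs := by
    intro j
    have h1 := hle j
    have h2 := hy j
    have h3 := hz j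
    simp only [Pi.zero_apply, Pi.sub_apply, signedCount] at h1 h2 h3 ⊢
    rcases lt_trichotomy (z j - y j) 0 with h | h | h
    · rw [Int.sign_eq_neg_one_of_neg h]
      omega
    · rw [h] at h1 ⊢
      simp only [Int.sign_zero, zero_mul]
      omega
    · rw [Int.sign_eq_one_of_pos h]
      omega
  have h1 := hmin (z - signedCount (z - y) C) (fun j => (hbd j).1)
    (by rw [mulVec_sub, h0, sub_zero])
  have h2 : C.card = ∑ j, (C.filter (fun p => p.1 = j)).card :=
    Finset.card_eq_sum_card_fiberwise (by simp)
  have h3 := Finset.sum_congr rfl (fun j (_ : j ∈ Finset.univ) => (hbd j).2)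
  rw [Finset.sum_add_distrib, ← h2] at h3
  have h4 := hC.card_pos
  simp only [Pi.sub_apply] at h1
  omega

/-- Proximity: if `W y` is close to `b` and `W z = b` has a nonnegative integer solution, then it
has one close to `y`. -/
theorem exists_intcone_solution_near {m n : ℕ} (hm : 0 < m) {Δ : ℤ} (hΔ0 : 0 ≤ Δ)
    (W : Matrix (Fin m) (Fin n) ℤ) (hΔ : ∀ i j, |W i j| ≤ Δ) (b : Fin m → ℤ)
    (hb : ∃ x : Fin n → ℤ, 0 ≤ x ∧ W *ᵥ x = b) (y : Fin n → ℤ) (hy : 0 ≤ y)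
    (hyb : ∀ r, 2 * |b r - (W *ᵥ y) r| ≤ m * Δ) :
    ∃ z : Fin n → ℤ, 0 ≤ z ∧ W *ᵥ z = b ∧
      3 * ∑ j, |z j - y j| ≤ 4 * (m * (2 * m * Δ + 1) ^ m) + 3 * m := by
  obtain ⟨z, ⟨hz, hzb⟩, hmin⟩ := (measure (fun z : Fin n → ℤ => ∑ j, (z j - y j).natAbs)).wf.has_min
    {z | 0 ≤ z ∧ W *ᵥ z = b} hb
  refine ⟨z, hz, hzb, ?_⟩
  have hmin' : ∀ z' : Fin n → ℤ, 0 ≤ z' → W *ᵥ z' = W *ᵥ z →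
      ∑ j, (z j - y j).natAbs ≤ ∑ j, (z' j - y j).natAbs :=
    fun z' h1 h2 => not_lt.1 (hmin z' ⟨h1, h2.trans hzb⟩)
  have hne := sum_signedColumn_ne_zero W y z hy hz hmin'
  set ι := Σ j, Fin ((z - y) j).natAbs
  set L := Fintype.card ι with hL
  have hLsum : ∑ j, |z j - y j| = (L : ℤ) := by
    simp [hL, ι, Fintype.card_sigma]
  rw [hLsum]
  have hK : 0 ≤ (m : ℤ) * (2 * m * Δ + 1) ^ m := by positivity
  rcases lt_or_ge L m with hLm | hLm
  · omega
  have hLpos : (0 : ℝ) < L := by exact_mod_cast hm.trans_le hLm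
  have hmR : (0 : ℝ) < m := by exact_mod_cast hm
  let v : ι → Fin m → ℝ := fun p r => (signedColumn W (z - y) p r : ℝ)
  have hv : ∀ p r, |v p r| ≤ (Δ : ℝ) := by
    intro p r
    have : |signedColumn W (z - y) p r| ≤ Δ := by
      rw [signedColumn, abs_mul]
      refine (mul_le_of_le_one_left (abs_nonneg _) ?_).trans (hΔ r p.1)
      rcases Int.sign_trichotomy ((z - y) p.1) with h | h | h <;> rw [h] <;> norm_num
    change |((signedColumn W (z - y) p r : ℤ) : ℝ)| ≤ Δ
    exact_mod_cast this
  obtain ⟨C, hanti, hC⟩ := exists_steinitz_chain_s10 v (by simpa using hLm)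
    (hm.trans_le hLm)
  rw [Module.finrank_fin_fun] at hC
  have hjL : ∀ j ∈ Finset.range (L - m + 1), j ≤ L - m := fun j hj =>
    Nat.lt_succ_iff.1 (Finset.mem_range.1 hj)
  have hjR : ∀ j ∈ Finset.range (L - m + 1), (j : ℝ) + m ≤ L := fun j hj => by
    have := hjL j hj
    have : j + m ≤ L := by omega
    exact_mod_cast this
  have hinj : ∀ j k, j < k → k ≤ L - m →
      (fun r => ∑ p ∈ C j, signedColumn W (z - y) p r) ≠
        fun r => ∑ p ∈ C k, signedColumn W (z - y) p r := by
    intro j k hjk hk heq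
    have hsub : C k ⊆ C j := hanti hjk.le
    refine hne (C j \ C k) ?_ ?_
    · rw [← Finset.card_pos, Finset.card_sdiff_of_subset hsub, (hC j (by omega)).1, (hC k hk).1]
      omega
    · ext r
      have h1 := congrFun heq r
      have h2 := Finset.sum_sdiff (f := fun p => signedColumn W (z - y) p r) hsub
      simp only [Pi.zero_apply] at h1 h2 ⊢
      linarith
  have hcard := card_le_of_near_segment hm (Δ := (Δ : ℝ)) (by exact_mod_cast hΔ0)
    (Finset.range (L - m + 1)) (fun j r => ∑ p ∈ C j, signedColumn W (z - y) p r) (by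
      intro j hj k hk heq
      rcases lt_trichotomy j k with h | h | h
      · exact absurd heq (hinj j k h (hjL k hk))
      · exact h
      · exact absurd heq.symm (hinj k j h (hjL j hj)))
    (fun j => ((L : ℝ) - j - m) / L)
    (fun j hj => div_nonneg (by linarith [hjR j hj]) hLpos.le)
    (fun j hj => by
      have : (0 : ℝ) ≤ j := Nat.cast_nonneg j
      rw [div_lt_one hLpos]
      linarith)
    (fun r => ∑ p, v p r)
    (fun r => by
      have h1 : ∑ p, signedColumn W (z - y) p r = b r - (W *ᵥ y) r := by
        have := congrFun (sum_signedColumn W (z - y) Finset.univ) r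
        rw [signedCount_univ, mulVec_sub, hzb] at this
        exact this
      have h2 : ∑ p, v p r = ((b r - (W *ᵥ y) r : ℤ) : ℝ) := by
        rw [← h1]
        push_cast
        rfl
      have h3 : (2 : ℝ) * |((b r - (W *ᵥ y) r : ℤ) : ℝ)| ≤ m * Δ := by exact_mod_cast hyb r
      rw [h2]
      linarith)
    (fun j hj r => by
      obtain ⟨hc, hw⟩ := hC j (hjL j hj)
      have := hw.abs_sum_sub_le hv r
      have hjL' : j ≤ L := by have := hjL j hj; omega
      rw [hc, Nat.cast_sub hjL'] at this
      simpa [v] using this)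
  rw [Finset.card_range] at hcard
  have hcard' : 3 * ((L - m + 1 : ℕ) : ℤ) ≤ 4 * (m * (2 * m * Δ + 1) ^ m) := by
    exact_mod_cast hcard
  omega

theorem abs_two_mul_mulVec_sub_inf_le {m n : ℕ} {Δ : ℤ}
    (W : Matrix (Fin m) (Fin n) ℤ) (hΔ : ∀ i j, |W i j| ≤ Δ) (y z : Fin n → ℤ) (r : Fin m) :
    2 * |(W *ᵥ (z - z ⊓ y)) r| ≤ |(W *ᵥ (z - y)) r| + Δ * ∑ j, |z j - y j| := by
  have h : 2 * (W *ᵥ (z - z ⊓ y)) r = (W *ᵥ (z - y)) r + ∑ j, W r j * |z j - y j| := by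
    simp only [mulVec, dotProduct, Finset.mul_sum, ← Finset.sum_add_distrib]
    refine Finset.sum_congr rfl fun j _ => ?_
    simp only [Pi.sub_apply, Pi.inf_apply]
    rcases le_total (z j) (y j) with h | h
    · rw [inf_eq_left.2 h, abs_of_nonpos (by linarith)]
      ring
    · rw [inf_eq_right.2 h, abs_of_nonneg (by linarith)]
      ring
  have h2 : |(∑ j, W r j * |z j - y j|)| ≤ Δ * ∑ j, |z j - y j| := by
    rw [Finset.mul_sum]
    refine (Finset.abs_sum_le_sum_abs _ _).trans (Finset.sum_le_sum fun j _ => ?_)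
    rw [abs_mul, abs_abs]
    exact mul_le_mul_of_nonneg_right (hΔ r j) (abs_nonneg _)
  calc 2 * |(W *ᵥ (z - z ⊓ y)) r| = |2 * (W *ᵥ (z - z ⊓ y)) r| := by simp [abs_mul]
    _ ≤ _ := h ▸ (abs_add_le _ _).trans (by gcongr)

theorem one_le_of_rank_pos {m n : ℕ} {Δ : ℤ} (W : Matrix (Fin m) (Fin n) ℤ)
    (hΔ : ∀ i j, |W i j| ≤ Δ) (hrank : 0 < (W.map (Int.cast : ℤ → ℚ)).rank) : 1 ≤ Δ := by
  by_contra h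
  have hW : W.map (Int.cast : ℤ → ℚ) = 0 := by
    ext i j
    have : W i j = 0 := Int.abs_lt_one_iff.1 (by linarith [hΔ i j])
    simp [this]
  simp [hW] at hrank

theorem abs_sub_mulVec_round_le {m : ℕ} {Δ : ℤ} (V : Matrix (Fin m) (Fin m) ℤ)
    (hΔ : ∀ i j, |V i j| ≤ Δ) (b : Fin m → ℤ) (x : Fin m → ℝ)
    (hx : V.map (Int.cast : ℤ → ℝ) *ᵥ x = fun i => (b i : ℝ)) (r : Fin m) :
    2 * |b r - (V *ᵥ fun k => round (x k)) r| ≤ m * Δ := by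
  have h : ((b r - (V *ᵥ fun k => round (x k)) r : ℤ) : ℝ) =
      ∑ k, (V r k : ℝ) * (x k - round (x k)) := by
    have := congrFun hx r
    simp only [mulVec, dotProduct, map_apply] at this ⊢
    push_cast
    rw [← this, ← Finset.sum_sub_distrib]
    exact Finset.sum_congr rfl fun k _ => by ring
  have h2 : |((b r - (V *ᵥ fun k => round (x k)) r : ℤ) : ℝ)| ≤ ∑ _k : Fin m, (Δ : ℝ) * (1 / 2) := by
    rw [h]
    refine (Finset.abs_sum_le_sum_abs _ _).trans (Finset.sum_le_sum fun k _ => ?_)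
    have h1 : |(V r k : ℝ)| ≤ Δ := by exact_mod_cast hΔ r k
    rw [abs_mul]
    exact mul_le_mul h1 (abs_sub_round _) (abs_nonneg _) ((abs_nonneg _).trans h1)
  have h3 : (2 : ℝ) * |((b r - (V *ᵥ fun k => round (x k)) r : ℤ) : ℝ)| ≤ m * Δ := by
    simp only [Finset.sum_const, Finset.card_univ, Fintype.card_fin, nsmul_eq_mul] at h2
    linarith
  exact_mod_cast h3

/-- For `W ∈ ℤ^{m×n}` of rank `m` with entries bounded by `Δ`, let
`𝒞 = {v ∈ intcone(W) : ‖v‖∞ ≤ Δ·m·(2mΔ+1)^m}`. Then for every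
`b ∈ cone(W) ∩ ℤ^m` one has `b ∈ intcone(W)` iff there is a basis `B` of columns
of `W` with `b ∈ cone(W_B)` and a `c ∈ 𝒞` with `b − c ∈ intcone(W_B)`. -/
theorem intcone_iff_basis_and_small_element (m n : ℕ) (Δ : ℤ)
    (W : Matrix (Fin m) (Fin n) ℤ) (hΔ : ∀ i j, |W i j| ≤ Δ)
    (hrank : (W.map (Int.cast : ℤ → ℚ)).rank = m)
    (b : Fin m → ℤ)
    -- `b ∈ cone(W)`
    (hb : ∃ x : Fin n → ℝ, 0 ≤ x ∧
      (W.map (Int.cast : ℤ → ℝ)).mulVec x = fun i => (b i : ℝ)) :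
    (∃ x : Fin n → ℤ, 0 ≤ x ∧ W.mulVec x = b) ↔
      ∃ B : Fin m → Fin n, Function.Injective B ∧
        LinearIndependent ℝ (fun j : Fin m => fun i : Fin m => (W i (B j) : ℝ)) ∧
        -- `b ∈ cone(W_B)`
        (∃ x : Fin m → ℝ, 0 ≤ x ∧
          ((W.submatrix id B).map (Int.cast : ℤ → ℝ)).mulVec x = fun i => (b i : ℝ)) ∧
        -- `c ∈ 𝒞` and `b − c ∈ intcone(W_B)`
        ∃ c : Fin m → ℤ,
          (∃ x : Fin n → ℤ, 0 ≤ x ∧ W.mulVec x = c) ∧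
          (∀ i, |c i| ≤ Δ * (m : ℤ) * (2 * (m : ℤ) * Δ + 1) ^ m) ∧
          (∃ y : Fin m → ℤ, 0 ≤ y ∧ (W.submatrix id B).mulVec y = b - c) := by
  constructor
  · intro hz₀
    rcases Nat.eq_zero_or_pos m with rfl | hm
    · exact ⟨Fin.elim0, fun i => i.elim0, linearIndependent_empty_type,
        ⟨0, le_rfl, Subsingleton.elim _ _⟩, 0, ⟨0, le_rfl, Subsingleton.elim _ _⟩,
        fun i => i.elim0, 0, le_rfl, Subsingleton.elim _ _⟩
    have hΔ1 : 1 ≤ Δ := one_le_of_rank_pos W hΔ (by rwa [hrank])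
    obtain ⟨x, hx0, hx⟩ := hb
    obtain ⟨B, hB, hli, xB, hxB0, hxB⟩ :=
      exists_basis_mem_cone _ (rank_map_intCast_real W hrank) x hx0
    rw [hx, submatrix_map] at hxB
    set y : Fin n → ℤ := Function.extend B (fun k => round (xB k)) 0 with hy
    have hy0 : 0 ≤ y := by
      intro j
      by_cases hj : ∃ k, B k = j
      · obtain ⟨k, rfl⟩ := hj
        rw [hy, hB.extend_apply, round_eq]
        exact Int.floor_nonneg.2 (by have : 0 ≤ xB k := hxB0 k; positivity)
      · rw [hy, Function.extend_apply' _ _ _ hj]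
    have hyb : ∀ r, 2 * |b r - (W *ᵥ y) r| ≤ m * Δ := by
      rw [hy, mulVec_extend_zero W hB]
      exact abs_sub_mulVec_round_le _ (fun i k => hΔ i (B k)) b xB hxB
    obtain ⟨z, hz0, hz, hzy⟩ :=
      exists_intcone_solution_near hm (by linarith) W hΔ b hz₀ y hy0 hyb
    refine ⟨B, hB, hli, ⟨xB, hxB0, hxB⟩, W *ᵥ (z - z ⊓ y),
      ⟨z - z ⊓ y, sub_nonneg.2 inf_le_left, rfl⟩, fun r => ?_,
      (z ⊓ y) ∘ B, fun k => le_inf hz0 hy0 (B k), ?_⟩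
    · have h1 := abs_two_mul_mulVec_sub_inf_le W hΔ y z r
      rw [mulVec_sub W z y, hz, Pi.sub_apply] at h1
      have h2 := hyb r
      have hm' : (1 : ℤ) ≤ m := by exact_mod_cast hm
      have hK : 3 ≤ (2 * (m : ℤ) * Δ + 1) ^ m := by
        have h3 : 3 ≤ 2 * (m : ℤ) * Δ + 1 := by nlinarith
        exact h3.trans (le_self_pow₀ (by linarith) hm.ne')
      generalize (2 * (m : ℤ) * Δ + 1) ^ m = K at hzy hK ⊢
      generalize ∑ j, |z j - y j| = L at hzy h1
      have h5 : 3 * (m + 2 * L) ≤ 12 * (m * K) := by nlinarith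
      have h6 := mul_le_mul_of_nonneg_left h5 (by linarith : 0 ≤ Δ)
      nlinarith
    · have hext : Function.extend B ((z ⊓ y) ∘ B) 0 = z ⊓ y := by
        ext j
        by_cases hj : ∃ k, B k = j
        · obtain ⟨k, rfl⟩ := hj
          rw [hB.extend_apply, Function.comp_apply]
        · rw [Function.extend_apply' _ _ _ hj, Pi.inf_apply, hy,
            Function.extend_apply' _ _ _ hj]
          exact (inf_eq_right.2 (hz0 j)).symm
      rw [← mulVec_extend_zero W hB, hext, mulVec_sub, hz, sub_sub_cancel]
  · rintro ⟨B, hB, -, -, c, ⟨x, hx0, rfl⟩, -, y, hy0, hy⟩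
    refine ⟨x + Function.extend B y 0, add_nonneg hx0 fun j => ?_, ?_⟩
    · by_cases hj : ∃ k, B k = j
      · obtain ⟨k, rfl⟩ := hj
        rw [hB.extend_apply]
        exact hy0 k
      · rw [Function.extend_apply' _ _ _ hj]
    · rw [mulVec_add, mulVec_extend_zero W hB, hy, add_sub_cancel]
end
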